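/- arXiv:2602.18302 — 2 statements merged into one kernel-verified Lean document; each statement's English description precedes it below -/
import Mathlib

section
/- Let α, δ ∈ ℂ be nonzero, let β, γ ∈ ℂ, and define the degree-one polynomials f(x) = αx + β and g(x) = δx + γ. Let c ∈ ℂ[x] be a polynomial such that c ≠ f^m as polynomials for every m ≥ 1 and c ≠ g^n as polynomials for every n ≥ 1. Suppose f and g generate a free semigroup under composition, i.e. any two distinct nonempty finite words in the letters f and g yield distinct composite functions ℂ → ℂ. Then the set of λ ∈ ℂ for which there exist integers m, n ≥ 1 with f^m(λ) = g^n(λ) and g^n(λ) = c(λ) is finite. -/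
section PartA
open Polynomial

/-- integration of a polynomial over `[0,1]` -/
noncomputable def intL (K : Type*) [Field K] : K[X] →ₗ[K] K :=
  Polynomial.lsum fun i => (LinearMap.mulRight K ((i + 1 : K)⁻¹))

lemma intL_monomial {K : Type*} [Field K] (i : ℕ) (a : K) :
    intL K (monomial i a) = a * ((i + 1 : K)⁻¹) := by
  simp [intL, Polynomial.lsum_apply]

lemma intL_derivative {K : Type*} [Field K] [CharZero K] (G : K[X]) :
    intL K (derivative G) = G.eval 1 - G.eval 0 := by
  induction G using Polynomial.induction_on' with
  | add p q hp hq => simp [hp, hq]; ring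
  | monomial n a =>
    rw [derivative_monomial, intL_monomial]
    rcases n with _ | n
    · simp
    · have : (n + 1 : K) ≠ 0 := by exact_mod_cast Nat.succ_ne_zero n
      simp [this]

lemma exists_antideriv {K : Type*} [Field K] [CharZero K] (P : K[X]) :
    ∃ F : K[X], derivative F = P := by
  induction P using Polynomial.induction_on' with
  | add p q hp hq =>
    obtain ⟨F, rfl⟩ := hp
    obtain ⟨G, rfl⟩ := hq
    exact ⟨F + G, by simp⟩
  | monomial n a =>
    refine ⟨monomial (n + 1) (a / (n + 1)), ?_⟩
    have : (n + 1 : K) ≠ 0 := by exact_mod_cast Nat.succ_ne_zero n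
    rw [derivative_monomial]
    simp [this]

lemma intL_seg {K : Type*} [Field K] [CharZero K] (F : K[X]) (p q : K) :
    F.eval q - F.eval p = (q - p) * intL K ((derivative F).comp (C p + C (q - p) * X)) := by
  have h := intL_derivative (F.comp (C p + C (q - p) * X))
  rw [derivative_comp] at h
  simp only [derivative_add, derivative_C, derivative_C_mul, derivative_X, zero_add, mul_one] at h
  rw [← smul_eq_C_mul, map_smul] at h
  simp only [smul_eq_mul] at h
  rw [h]
  simp

lemma intL_beta {K : Type*} [Field K] [CharZero K] (j i : ℕ) :
    intL K (X ^ i * (1 - X) ^ j) = (i.factorial * j.factorial : K) / ((i + j + 1).factorial : K) := by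
  induction j generalizing i with
  | zero =>
    have := intL_monomial (K := K) i 1
    rw [← X_pow_eq_monomial] at this
    simp only [pow_zero, mul_one, this, Nat.factorial_zero, Nat.cast_one, add_zero, one_mul,
      Nat.factorial_succ]
    push_cast
    have h1 : (i + 1 : K) ≠ 0 := by exact_mod_cast Nat.succ_ne_zero i
    have h2 : (i.factorial : K) ≠ 0 := by exact_mod_cast i.factorial_ne_zero
    field_simp
  | succ j ih =>
    have h := intL_derivative (K := K) (X ^ (i+1) * (1 - X) ^ (j + 1))
    have e : derivative ((X : K[X]) ^ (i+1) * (1 - X) ^ (j + 1)) =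
        (i + 1 : K) • (X ^ i * (1 - X) ^ (j + 1)) - (j + 1 : K) • (X ^ (i+1) * (1 - X) ^ j) := by
      simp only [derivative_mul, derivative_pow, derivative_X, derivative_sub, derivative_one,
        smul_eq_C_mul]
      simp
      ring
    rw [e, map_sub, map_smul, map_smul, ih] at h
    simp at h
    have h1 : (i + 1 : K) ≠ 0 := by exact_mod_cast Nat.succ_ne_zero i
    have h3 : i + 1 + j + 1 = i + (j + 1) + 1 := by ring
    rw [h3] at h
    have h2 : ((i + (j + 1) + 1).factorial : K) ≠ 0 := by
      exact_mod_cast (i + (j + 1) + 1).factorial_ne_zero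
    rw [Nat.factorial_succ i] at h
    rw [Nat.factorial_succ j]
    push_cast at h ⊢
    rw [sub_eq_zero] at h
    apply mul_left_cancel₀ h1
    rw [h]
    field_simp

/-- The Padé polynomials. -/
def padeW {R : Type*} [CommRing R] (A B C : ℕ) (b c : R) : R :=
  ∑ j ∈ Finset.range (C + 1), (((A + j).choose A * (B + C - j).choose B : ℕ) : R) *
    ((-b) ^ j * c ^ (C - j))

lemma pade_piece {K : Type*} [Field K] [CharZero K] (A B D : ℕ) (p q r : K) (F : K[X])
    (hF : derivative F = (X - C p) ^ A * (X - C q) ^ B * (X - C r) ^ D) :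
    F.eval q - F.eval p = ((A.factorial * B.factorial * D.factorial : K) /
      ((A + B + D + 1).factorial : K)) *
      ((-1) ^ B * (q - p) ^ (A + B + 1) * padeW A B D (r - q) (p - r)) := by
  rw [intL_seg, hF]
  have e : ((X - C p) ^ A * (X - C q) ^ B * (X - C r) ^ D).comp (C p + C (q - p) * X)
      = ∑ j ∈ Finset.range (D + 1), ((q-p)^(A+B) * (-1)^B *
          ((-(r-q))^j * (p-r)^(D-j) * (D.choose j : K))) • ((X : K[X]) ^ (A + j) * (1 - X) ^ (B + D - j)) := by
    have e1 : (C p + C (q-p) * X - C r : K[X]) = C (-(r-q)) * X + C (p - r) * (1 - X) := by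
      simp only [C_sub, C_neg]; ring
    have e2 : (C p + C (q-p) * X - C q : K[X]) = C (q-p) * (-1) * (1 - X) := by
      simp only [C_sub]; ring
    simp only [mul_comp, pow_comp, sub_comp, X_comp, C_comp]
    rw [e1, e2, add_pow, Finset.mul_sum]
    refine Finset.sum_congr rfl fun j hj => ?_
    have hj' : j ≤ D := Nat.lt_succ_iff.mp (Finset.mem_range.mp hj)
    have e3 : B + D - j = B + (D - j) := by omega
    rw [smul_eq_C_mul, e3]
    simp only [C_mul, C_pow, C_neg, C_1, map_natCast, pow_add, mul_pow]
    ring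
  rw [e, map_sum]
  unfold padeW
  simp only [map_smul, intL_beta, Finset.mul_sum, smul_eq_mul]
  refine Finset.sum_congr rfl fun j hj => ?_
  have hj' : j ≤ D := Nat.lt_succ_iff.mp (Finset.mem_range.mp hj)
  have e3 : B + D - j = B + (D - j) := by omega
  have e4 : A + j + (B + (D - j)) + 1 = A + B + D + 1 := by omega
  rw [e3, e4]
  have f1 : ((A + j).choose A : K) * (A.factorial * j.factorial) = (A + j).factorial := by
    have := Nat.add_choose_mul_factorial_mul_factorial A j
    rw [← this, Nat.choose_symm_add]; push_cast; ring
  have f2 : ((B + (D - j)).choose B : K) * (B.factorial * (D-j).factorial) = (B + (D-j)).factorial := by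
    have := Nat.add_choose_mul_factorial_mul_factorial B (D-j)
    rw [← this, Nat.choose_symm_add]; push_cast; ring
  have f3 : (D.choose j : K) * (j.factorial * (D-j).factorial) = D.factorial := by
    have := Nat.choose_mul_factorial_mul_factorial hj'
    rw [← this]; push_cast; ring
  rw [← f1, ← f2, ← f3]
  push_cast
  ring

lemma pade_identity {K : Type*} [Field K] [CharZero K] (A B D : ℕ) (a b c : K) (h : a + b + c = 0) :
    (-1) ^ B * a ^ (A + B + 1) * padeW A B D b c + (-1) ^ D * b ^ (B + D + 1) * padeW B D A c a
      + (-1) ^ A * c ^ (D + A + 1) * padeW D A B a b = 0 := by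
  obtain ⟨F, hF⟩ := exists_antideriv ((X - C 0) ^ A * (X - C a) ^ B * (X - C (a + b)) ^ D : K[X])
  have h1 := pade_piece A B D 0 a (a+b) F hF
  have h2 := pade_piece B D A a (a+b) 0 F (by rw [hF]; ring)
  have h3 := pade_piece D A B (a+b) 0 a F (by rw [hF]; ring)
  have hc : c = -(a+b) := by linear_combination h
  have e2 : B + D + A + 1 = A + B + D + 1 := by ring
  have e3 : D + A + B + 1 = A + B + D + 1 := by ring
  rw [e2] at h2
  rw [e3] at h3
  have hk : ((A.factorial * B.factorial * D.factorial : K) / ((A + B + D + 1).factorial : K)) ≠ 0 := by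
    refine div_ne_zero (mul_ne_zero (mul_ne_zero ?_ ?_) ?_) ?_ <;>
      exact_mod_cast Nat.factorial_ne_zero _
  apply mul_left_cancel₀ hk
  rw [mul_zero]
  subst hc
  simp only [add_sub_cancel_left, sub_zero, zero_sub] at h1 h2 h3
  have s2 : a - (a + b) = -b := by ring
  linear_combination (exp := 1) -h1 - h2 - h3

end PartA

section PartB
open Polynomial

lemma padeW_eval {K : Type*} [Field K] (A B D : ℕ) (b c : K[X]) (x : K) :
    (padeW A B D b c).eval x = padeW A B D (b.eval x) (c.eval x) := by
  simp [padeW, eval_finsetSum]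

lemma padeW_natDegree {K : Type*} [Field K] (A B D : ℕ) (b c : K[X]) (hb : b.natDegree ≤ 1)
    (hc : c.natDegree ≤ 1) : (padeW A B D b c).natDegree ≤ D := by
  unfold padeW
  apply natDegree_sum_le_of_forall_le
  intro j hj
  have hj' : j ≤ D := Nat.lt_succ_iff.mp (Finset.mem_range.mp hj)
  have h1 : ((-b) ^ j).natDegree ≤ j := by
    refine natDegree_pow_le.trans ?_
    rw [natDegree_neg]; nlinarith
  have h2 : (c ^ (D - j)).natDegree ≤ D - j := by
    refine natDegree_pow_le.trans ?_
    nlinarith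
  have h3 := natDegree_mul_le (p := ((((A + j).choose A * (B + D - j).choose B : ℕ) : K[X])))
    (q := (-b) ^ j * c ^ (D - j))
  have h4 := natDegree_mul_le (p := (-b) ^ j) (q := c ^ (D - j))
  rw [natDegree_natCast] at h3
  omega

/-- The first vector of Padé values. -/
def pv1 {R : Type*} [CommRing R] (N : ℕ) (x : R) : Fin 3 → R :=
  ![padeW N N N (1 - x) (-1), padeW N N N (-1) x, padeW N N N x (1 - x)]

/-- The second vector of Padé values. -/
def pv2 {R : Type*} [CommRing R] (N : ℕ) (x : R) : Fin 3 → R :=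
  ![x * padeW (N+1) N N (1 - x) (-1), padeW N N (N+1) (-1) x, padeW N (N+1) N x (1 - x)]

lemma pv1_rel {K : Type*} [Field K] [CharZero K] (N : ℕ) (x : K) :
    x ^ (2 * N + 1) * pv1 N x 0 + (1 - x) ^ (2 * N + 1) * pv1 N x 1 = pv1 N x 2 := by
  have h := pade_identity N N N x (1 - x) (-1) (by ring)
  have e : N + N + 1 = 2 * N + 1 := by ring
  rw [e] at h
  have h0 : ((-1 : K)) ^ N ≠ 0 := by simp
  have h1 : (-1 : K) ^ (2 * N + 1) = -1 := Odd.neg_one_pow ⟨N, rfl⟩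
  rw [h1] at h
  apply mul_left_cancel₀ h0
  simp only [pv1, Matrix.cons_val]
  linear_combination h

lemma pv2_rel {K : Type*} [Field K] [CharZero K] (N : ℕ) (x : K) :
    x ^ (2 * N + 1) * pv2 N x 0 + (1 - x) ^ (2 * N + 1) * pv2 N x 1 = pv2 N x 2 := by
  have h := pade_identity (N+1) N N x (1 - x) (-1) (by ring)
  have e : N + N + 1 = 2 * N + 1 := by ring
  have e' : N + 1 + N + 1 = 2 * N + 1 + 1 := by ring
  have e'' : N + (N + 1) + 1 = 2 * N + 1 + 1 := by ring
  rw [e, e', e''] at h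
  have h0 : ((-1 : K)) ^ N ≠ 0 := by simp
  have h1 : (-1 : K) ^ (2 * N + 1) = -1 := Odd.neg_one_pow ⟨N, rfl⟩
  rw [pow_succ (-1 : K) (2 * N + 1), h1, pow_succ (-1 : K) N] at h
  apply mul_left_cancel₀ h0
  simp only [pv2, Matrix.cons_val]
  linear_combination h

lemma pv_det_zero {K : Type*} [Field K] [CharZero K] (N : ℕ) :
    pv1 N (0 : K) 2 * pv2 N (0 : K) 0 - pv1 N (0 : K) 0 * pv2 N (0 : K) 2 ≠ 0 := by
  have h1 : pv2 N (0 : K) 0 = 0 := by simp [pv2]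
  rw [h1, mul_zero, zero_sub, neg_ne_zero]
  apply mul_ne_zero
  · have : pv1 N (0 : K) 0 = (-1) ^ N * ((∑ j ∈ Finset.range (N + 1),
        ((N + j).choose N * (N + N - j).choose N) : ℕ) : K) := by
      simp only [pv1, padeW, Matrix.cons_val_zero, sub_zero]
      push_cast
      rw [Finset.mul_sum]
      refine Finset.sum_congr rfl fun j hj => ?_
      have hj' : j ≤ N := Nat.lt_succ_iff.mp (Finset.mem_range.mp hj)
      rw [← pow_add, Nat.add_sub_cancel' hj']
      ring
    rw [this]
    apply mul_ne_zero (by simp)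
    rw [Nat.cast_ne_zero]
    apply ne_of_gt
    apply Finset.sum_pos
    · intro j hj
      have hj' : j ≤ N := Nat.lt_succ_iff.mp (Finset.mem_range.mp hj)
      apply Nat.mul_pos <;> apply Nat.choose_pos <;> omega
    · simp
  · have : pv2 N (0 : K) 2 = (((N + 1 + N).choose (N + 1) : ℕ) : K) := by
      simp only [pv2, padeW, Matrix.cons_val]
      rw [Finset.sum_range_succ', Finset.sum_eq_zero]
      · simp
      · intro j hj; simp
    rw [this, Nat.cast_ne_zero]
    apply ne_of_gt
    apply Nat.choose_pos; omega

lemma pv_det {K : Type*} [Field K] [CharZero K] (N : ℕ) (x : K) :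
    pv1 N x 0 * pv2 N x 1 - pv1 N x 1 * pv2 N x 0 ≠ 0 := by
  let P : K[X] := pv1 N (X : K[X]) 1 * pv2 N X 0 - pv1 N X 0 * pv2 N X 1
  let Q : K[X] := pv1 N (X : K[X]) 2 * pv2 N X 0 - pv1 N X 0 * pv2 N X 2
  have ev1 : ∀ i (y : K), (pv1 N (X : K[X]) i).eval y = pv1 N y i := by
    intro i y; fin_cases i <;> simp [pv1, padeW_eval]
  have ev2 : ∀ i (y : K), (pv2 N (X : K[X]) i).eval y = pv2 N y i := by
    intro i y; fin_cases i <;> simp [pv2, padeW_eval]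
  have hPQ : (1 - X) ^ (2 * N + 1) * P = Q := by
    apply Polynomial.funext
    intro y
    simp only [P, Q, eval_mul, eval_sub, eval_pow, eval_one, eval_X, ev1, ev2]
    rw [← pv1_rel, ← pv2_rel]
    ring
  have hd1 : (1 - X : K[X]).natDegree = 1 := by
    rw [← neg_sub, natDegree_neg]
    simpa using natDegree_X_sub_C (1 : K)
  have hd2 : (-1 : K[X]).natDegree ≤ 1 := by simp
  have hd3 : (X : K[X]).natDegree ≤ 1 := by simp
  have hQ : Q.natDegree ≤ 2 * N + 1 := by
    refine (natDegree_sub_le _ _).trans (max_le ?_ ?_)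
    · refine natDegree_mul_le.trans ?_
      have a1 : (pv1 N (X : K[X]) 2).natDegree ≤ N := padeW_natDegree N N N _ _ hd3 hd1.le
      have a2 : (pv2 N (X : K[X]) 0).natDegree ≤ 1 + N := by
        refine natDegree_mul_le.trans ?_
        have := padeW_natDegree (N+1) N N _ _ hd1.le hd2
        simp only [natDegree_X]
        omega
      omega
    · refine natDegree_mul_le.trans ?_
      have a1 : (pv1 N (X : K[X]) 0).natDegree ≤ N := padeW_natDegree N N N _ _ hd1.le hd2
      have a2 : (pv2 N (X : K[X]) 2).natDegree ≤ N := padeW_natDegree N (N+1) N _ _ hd3 hd1.le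
      omega
  have hQ0 : Q.eval 0 ≠ 0 := by
    simp only [Q, eval_mul, eval_sub, ev1, ev2]
    exact pv_det_zero N
  have hP0 : P ≠ 0 := by
    intro h; rw [h, mul_zero] at hPQ; rw [← hPQ] at hQ0; simp at hQ0
  have hX0 : (1 - X : K[X]) ≠ 0 := by
    intro h; rw [h] at hd1; simp at hd1
  have hdeg : P.natDegree = 0 := by
    rw [← hPQ, natDegree_mul (pow_ne_zero _ hX0) hP0, natDegree_pow, hd1] at hQ
    omega
  obtain ⟨k, hk⟩ := natDegree_eq_zero.mp hdeg
  have hk0 : k ≠ 0 := by rintro rfl; simp at hk; exact hP0 hk.symm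
  have : P.eval x = k := by rw [← hk]; simp
  simp only [P, eval_mul, eval_sub, ev1, ev2] at this
  intro h
  apply hk0
  rw [← this]
  linear_combination -h

end PartB

section PartC

lemma padeW_bound {K : Type*} [Field K] (v : AbsoluteValue K ℝ) (n A B D : ℕ) (hA : A ≤ n)
    (hB : B ≤ n) (hD : D ≤ n) (M : ℝ) (b c : K) (hb : v b ≤ M) (hc : v c ≤ M) :
    v (padeW A B D b c) ≤ 2 ^ (5 * n) * M ^ D := by
  have hM0 : 0 ≤ M := (v.nonneg b).trans hb
  unfold padeW
  refine (v.sum_le _ _).trans ?_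
  have key : ∀ j ∈ Finset.range (D + 1), v ((((A + j).choose A * (B + D - j).choose B : ℕ) : K) *
    ((-b) ^ j * c ^ (D - j))) ≤ 2 ^ (4 * n) * M ^ D := by
    intro j hj
    have hj' : j ≤ D := Nat.lt_succ_iff.mp (Finset.mem_range.mp hj)
    rw [map_mul, map_mul, map_pow, map_pow, v.map_neg]
    have h1 : v (((A + j).choose A * (B + D - j).choose B : ℕ) : K) ≤ 2 ^ (4 * n) := by
      have h2 : v (((A + j).choose A * (B + D - j).choose B : ℕ) : K) ≤
          (((A + j).choose A * (B + D - j).choose B : ℕ) : ℝ) := by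
        generalize ((A + j).choose A * (B + D - j).choose B : ℕ) = m
        induction m with
        | zero => simp
        | succ m ih =>
          push_cast
          refine (v.add_le _ _).trans ?_
          rw [v.map_one]; linarith
      refine h2.trans ?_
      have h3 : (A + j).choose A * (B + D - j).choose B ≤ 2 ^ (4 * n) := by
        calc _ ≤ 2 ^ (A + j) * 2 ^ (B + D - j) :=
              Nat.mul_le_mul (Nat.choose_le_two_pow _ _) (Nat.choose_le_two_pow _ _)
          _ = 2 ^ (A + j + (B + D - j)) := (pow_add _ _ _).symm
          _ ≤ _ := Nat.pow_le_pow_right (by norm_num) (by omega)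
      exact_mod_cast h3
    have h4 : v b ^ j * v c ^ (D - j) ≤ M ^ D := by
      calc _ ≤ M ^ j * M ^ (D - j) := by gcongr
        _ = M ^ D := by rw [← pow_add, Nat.add_sub_cancel' hj']
    gcongr
  refine (Finset.sum_le_sum key).trans ?_
  rw [Finset.sum_const, Finset.card_range, nsmul_eq_mul]
  have h5 : ((D + 1 : ℕ) : ℝ) ≤ 2 ^ n := by
    have : D + 1 ≤ 2 ^ n := (Nat.succ_le_succ hD).trans (Nat.lt_two_pow_self)
    exact_mod_cast this
  calc _ ≤ (2 : ℝ) ^ n * (2 ^ (4 * n) * M ^ D) := by gcongr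
    _ = _ := by rw [← mul_assoc, ← pow_add]; congr 2; ring

lemma pv_bound {K : Type*} [Field K] (v : AbsoluteValue K ℝ) (N : ℕ) (x : K) (M : ℝ) (h1 : 1 ≤ M)
    (hx : v x ≤ M) (hx' : v (1 - x) ≤ M) (i : Fin 3) :
    v (pv1 N x i) ≤ 2 ^ (5 * (N + 1)) * M ^ (N + 1) ∧
    v (pv2 N x i) ≤ 2 ^ (5 * (N + 1)) * M ^ (N + 1) := by
  have hm : v (-1) ≤ M := by simpa using h1
  have hM : M ^ N ≤ M ^ (N + 1) := pow_le_pow_right₀ h1 (Nat.le_succ N)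
  have hM' : (2 : ℝ) ^ (5 * (N + 1)) * M ^ N ≤ 2 ^ (5 * (N + 1)) * M ^ (N + 1) := by gcongr
  constructor
  · fin_cases i
    · exact (padeW_bound v (N+1) N N N (by omega) (by omega) (by omega) M _ _ hx' hm).trans hM'
    · exact (padeW_bound v (N+1) N N N (by omega) (by omega) (by omega) M _ _ hm hx).trans hM'
    · exact (padeW_bound v (N+1) N N N (by omega) (by omega) (by omega) M _ _ hx hx').trans hM'
  · fin_cases i
    · have := (padeW_bound v (N+1) (N+1) N N (by omega) (by omega) (by omega) M _ _ hx' hm)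
      change v (x * padeW (N+1) N N (1 - x) (-1)) ≤ _
      rw [map_mul]
      calc _ ≤ M * (2 ^ (5 * (N + 1)) * M ^ N) := by gcongr
        _ = _ := by rw [pow_succ M N]; ring
    · exact (padeW_bound v (N+1) N N (N+1) (by omega) (by omega) (by omega) M _ _ hm hx)
    · exact (padeW_bound v (N+1) N (N+1) N (by omega) (by omega) (by omega) M _ _ hx hx').trans hM'

lemma local_bound {K : Type*} [Field K] (v : AbsoluteValue K ℝ) (k : ℕ) (x y : K) (hx : x ≠ 0)
    (hx1 : 1 - x ≠ 0) (P : Fin 3 → K) (hP : x ^ k * P 0 + (1 - x) ^ k * P 1 = P 2) (T : ℝ)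
    (hT : ∀ i, v (P i) ≤ T) (M H : ℝ) (hM : M = max (max (v x) (v (1 - x))) 1)
    (hH : H = max (max (v (y / x ^ k)) (v ((1 - y) / (1 - x) ^ k))) 1) :
    v (P 0 * ((1 - y) / (1 - x) ^ k) - P 1 * (y / x ^ k)) * M ^ k ≤ 2 * T * H := by
  set w1 := y / x ^ k with hw1
  set w2 := (1 - y) / (1 - x) ^ k with hw2
  set E := P 0 * w2 - P 1 * w1 with hE
  have y1 : x ^ k * w1 = y := by rw [hw1]; field_simp
  have y2 : (1 - x) ^ k * w2 = 1 - y := by rw [hw2]; field_simp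
  have T0 : 0 ≤ T := (v.nonneg _).trans (hT 0)
  have H1 : 1 ≤ H := hH ▸ le_max_right _ _
  have a1 : v w1 ≤ H := hH ▸ (le_max_left _ _).trans (le_max_left _ _)
  have a2 : v w2 ≤ H := hH ▸ (le_max_right _ _).trans (le_max_left _ _)
  have gen : ∀ p q s t : K, v p ≤ T → v q ≤ T → v s ≤ H → v t ≤ H → v (p * s - q * t) ≤ 2 * T * H := by
    intro p q s t hp hq hs ht
    have : v (p * s - q * t) ≤ v (p * s) + v (q * t) := by
      have := v.add_le (p * s) (-(q * t))
      rwa [v.map_neg, ← sub_eq_add_neg] at this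
    refine this.trans ?_
    rw [map_mul, map_mul]
    have : v p * v s ≤ T * H := by gcongr
    have : v q * v t ≤ T * H := by gcongr
    linarith
  have b0 : v E ≤ 2 * T * H := gen _ _ _ _ (hT 0) (hT 1) a2 a1
  have one : v 1 ≤ H := by simpa using H1
  have b1 : v E * v x ^ k ≤ 2 * T * H := by
    rw [← map_pow, ← map_mul]
    have : E * x ^ k = P 2 * w2 - P 1 * 1 := by
      rw [hE, ← hP]
      linear_combination (-P 1) * y1 - P 1 * y2
    rw [this]
    exact gen _ _ _ _ (hT 2) (hT 1) a2 one
  have b2 : v E * v (1 - x) ^ k ≤ 2 * T * H := by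
    rw [← map_pow, ← map_mul]
    have : E * (1 - x) ^ k = P 0 * 1 - P 2 * w1 := by
      rw [hE, ← hP]
      linear_combination (P 0) * y1 + P 0 * y2
    rw [this]
    exact gen _ _ _ _ (hT 0) (hT 2) one a1
  rw [hM]
  rcases max_choice (max (v x) (v (1 - x))) 1 with h | h <;> rw [h]
  · rcases max_choice (v x) (v (1 - x)) with h | h <;> rw [h] <;> assumption
  · simpa using b0

lemma log_max_one_le (a b : ℝ) : Real.log (max (max a b) 1) ≤ |Real.log a| + |Real.log b| := by
  rcases max_choice (max a b) 1 with h | h <;> rw [h]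
  · rcases max_choice a b with h | h <;> rw [h]
    · have := le_abs_self (Real.log a); have := abs_nonneg (Real.log b); linarith
    · have := le_abs_self (Real.log b); have := abs_nonneg (Real.log a); linarith
  · simp; positivity

lemma bounded_of_gap {V : Type*} [NormedAddCommGroup V] [NormedSpace ℝ V] [ProperSpace V]
    (E : Set V) (c : ℝ) (hc : 1 ≤ c)
    (h : ∀ x ∈ E, ∀ y ∈ E, ∀ N : ℕ, N * ‖x‖ ≤ c * (‖y - ((2 * N + 1 : ℕ) : ℝ) • x‖ + N + 1)) :
    ∃ B, ∀ x ∈ E, ‖x‖ ≤ B := by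
  by_contra! hE
  choose u huE hu using fun n : ℕ => hE (n + 1)
  have hpos : ∀ n, 0 < ‖u n‖ := fun n => lt_trans (by positivity) (hu n)
  obtain ⟨z, -, φ, hφ, hlim⟩ := (isCompact_sphere (0 : V) 1).tendsto_subseq
    (x := fun n => ‖u n‖⁻¹ • u n) (fun n => by
      simp [norm_smul, (hpos n).ne'])
  have hcau := hlim.cauchySeq
  rw [Metric.cauchySeq_iff] at hcau
  obtain ⟨n0, hn0⟩ := hcau (1 / (8 * c)) (by positivity)
  obtain ⟨n1, hn1⟩ := exists_nat_ge (2 * c)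
  set x := u (φ (max n0 n1)) with hx
  have hxbig : 2 * c ≤ ‖x‖ := by
    have h1 := hu (φ (max n0 n1))
    have h2 : n1 ≤ φ (max n0 n1) := (le_max_right _ _).trans (hφ.id_le _)
    have h3 : (n1 : ℝ) ≤ φ (max n0 n1) := by exact_mod_cast h2
    linarith
  obtain ⟨n2, hn2⟩ := exists_nat_ge ((8 * c + 13) * ‖x‖)
  set y := u (φ (max n0 n2)) with hy
  have hybig : (8 * c + 13) * ‖x‖ ≤ ‖y‖ := by
    have h1 := hu (φ (max n0 n2))
    have h2 : n2 ≤ φ (max n0 n2) := (le_max_right _ _).trans (hφ.id_le _)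
    have h3 : (n2 : ℝ) ≤ φ (max n0 n2) := by exact_mod_cast h2
    linarith
  have hd := hn0 (max n0 n2) (le_max_left _ _) (max n0 n1) (le_max_left _ _)
  simp only [Function.comp] at hd
  rw [← hx, ← hy, dist_eq_norm] at hd
  have hx0 : 0 < ‖x‖ := hpos _
  have hy0 : 0 < ‖y‖ := hpos _
  set t := ‖y‖ / ‖x‖ with ht
  have ht' : ‖y‖ = t * ‖x‖ := by rw [ht]; field_simp
  have htb : 8 * c + 13 ≤ t := by rw [ht, le_div_iff₀ hx0]; exact hybig
  have hyt : ‖y - t • x‖ ≤ 1 / (8 * c) * ‖y‖ := by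
    have : y - t • x = ‖y‖ • (‖y‖⁻¹ • y - ‖x‖⁻¹ • x) := by
      rw [smul_sub, smul_smul, smul_smul, mul_inv_cancel₀ hy0.ne', one_smul, ht, div_eq_mul_inv]
    rw [this, norm_smul, norm_norm, mul_comm]
    gcongr
  set N := ⌊t / 2⌋₊ with hN
  have N1 : (N : ℝ) ≤ t / 2 := Nat.floor_le (by linarith)
  have N2 : t / 2 < N + 1 := Nat.lt_floor_add_one _
  have hyN : ‖y - ((2 * N + 1 : ℕ) : ℝ) • x‖ ≤ 1 / (8 * c) * ‖y‖ + ‖x‖ := by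
    have e : y - ((2 * N + 1 : ℕ) : ℝ) • x = (y - t • x) + (t - ((2 * N + 1 : ℕ) : ℝ)) • x := by
      rw [sub_smul]; abel
    rw [e]
    refine (norm_add_le _ _).trans ?_
    rw [norm_smul]
    have : ‖t - ((2 * N + 1 : ℕ) : ℝ)‖ ≤ 1 := by
      rw [Real.norm_eq_abs, abs_le]; push_cast; constructor <;> linarith
    nlinarith
  have hfin := h x (huE _) y (huE _) N
  have h1 : N * ‖x‖ ≤ c * (1 / (8 * c) * (t * ‖x‖) + ‖x‖ + N + 1) := by
    rw [ht'] at hyN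
    refine hfin.trans ?_
    gcongr
  have h2 : c * (1 / (8 * c) * (t * ‖x‖) + ‖x‖ + N + 1) = t * ‖x‖ / 8 + c * ‖x‖ + c * N + c := by
    field_simp
  rw [h2] at h1
  have h3 : c * N ≤ N * ‖x‖ / 2 := by nlinarith [(Nat.cast_nonneg N : (0:ℝ) ≤ N)]
  have h4 : N * ‖x‖ / 2 ≤ (t / 8 + c + 1 / 2) * ‖x‖ := by nlinarith
  have h5 : (N : ℝ) / 2 ≤ t / 8 + c + 1 / 2 := by
    by_contra hcon
    push Not at hcon
    nlinarith
  linarith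

end PartC

section PartD

lemma padeW_mem {K : Type*} [Field K] (O : Subring K) (A B D : ℕ) (b c : K) (hb : b ∈ O)
    (hc : c ∈ O) : padeW A B D b c ∈ O := by
  unfold padeW
  refine sum_mem fun j _ => mul_mem (natCast_mem _ _) (mul_mem (pow_mem (neg_mem hb) _) (pow_mem hc _))

lemma pv_mem {K : Type*} [Field K] (O : Subring K) (N : ℕ) (x : K) (hx : x ∈ O) (i : Fin 3) :
    pv1 N x i ∈ O ∧ pv2 N x i ∈ O := by
  have h1 : 1 - x ∈ O := sub_mem (one_mem _) hx
  have h2 : (-1 : K) ∈ O := neg_mem (one_mem _)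
  constructor
  · fin_cases i <;> exact padeW_mem O _ _ _ _ _ (by assumption) (by assumption)
  · fin_cases i
    · exact mul_mem hx (padeW_mem O _ _ _ _ _ (by assumption) (by assumption))
    · exact padeW_mem O _ _ _ _ _ (by assumption) (by assumption)
    · exact padeW_mem O _ _ _ _ _ (by assumption) (by assumption)

lemma main_ineq {K : Type*} [Field K] [CharZero K] {ι : Type*} [Fintype ι]
    (v : ι → AbsoluteValue K ℝ) (n : ι → ℝ) (hn : ∀ i, 1 ≤ n i) (O : Subring K)
    (hO : ∀ a ∈ O, a ≠ 0 → 0 ≤ ∑ i, n i * Real.log (v i a))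
    (x y : K) (hx : x ∈ O) (hx' : x⁻¹ ∈ O) (h1x : (1 - x)⁻¹ ∈ O) (x0 : x ≠ 0) (x1 : 1 - x ≠ 0)
    (hy : y ∈ O) (y0 : y ≠ 0) (N : ℕ) :
    N * ∑ i, n i * Real.log (max (max (v i x) (v i (1 - x))) 1) ≤
      (∑ i, n i * (|Real.log (v i (y / x ^ (2 * N + 1)))| +
        |Real.log (v i ((1 - y) / (1 - x) ^ (2 * N + 1)))|)) +
      (∑ i, n i) * (6 * (N + 1) * Real.log 2) := by
  set k := 2 * N + 1 with hk
  set w1 := y / x ^ k with hw1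
  set w2 := (1 - y) / (1 - x) ^ k with hw2
  have w1m : w1 ∈ O := by rw [hw1, div_eq_mul_inv, ← inv_pow]; exact mul_mem hy (pow_mem hx' _)
  have w2m : w2 ∈ O := by
    rw [hw2, div_eq_mul_inv, ← inv_pow]; exact mul_mem (sub_mem (one_mem _) hy) (pow_mem h1x _)
  have w10 : w1 ≠ 0 := div_ne_zero y0 (pow_ne_zero _ x0)
  obtain ⟨P, hPm, hPr, hPb, hE⟩ : ∃ P : Fin 3 → K, (∀ i, P i ∈ O) ∧
      (x ^ k * P 0 + (1 - x) ^ k * P 1 = P 2) ∧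
      (∀ i j, v i (P j) ≤ 2 ^ (5 * (N + 1)) * (max (max (v i x) (v i (1 - x))) 1) ^ (N + 1)) ∧
      P 0 * w2 - P 1 * w1 ≠ 0 := by
    have hb := fun i => pv_bound (v i) N x (max (max (v i x) (v i (1 - x))) 1) (le_max_right _ _)
      ((le_max_left _ _).trans (le_max_left _ _)) ((le_max_right _ _).trans (le_max_left _ _))
    by_cases h : pv1 N x 0 * w2 - pv1 N x 1 * w1 ≠ 0
    · exact ⟨pv1 N x, fun i => (pv_mem O N x hx i).1, pv1_rel N x, fun i j => (hb i j).1, h⟩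
    · refine ⟨pv2 N x, fun i => (pv_mem O N x hx i).2, pv2_rel N x, fun i j => (hb i j).2, ?_⟩
      intro h'
      push Not at h
      apply pv_det N x
      apply mul_left_cancel₀ w10
      rw [mul_zero]
      linear_combination pv1 N x 0 * (-h') + pv2 N x 0 * h
  set E := P 0 * w2 - P 1 * w1 with hEdef
  have hEm : E ∈ O := sub_mem (mul_mem (hPm _) w2m) (mul_mem (hPm _) w1m)
  have h0 := hO E hEm hE
  have hloc : ∀ i, Real.log (v i E) ≤ (|Real.log (v i w1)| + |Real.log (v i w2)|)
      + 6 * (N + 1) * Real.log 2 - N * Real.log (max (max (v i x) (v i (1 - x))) 1) := by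
    intro i
    set M := max (max (v i x) (v i (1 - x))) 1 with hM
    have hb := local_bound (v i) k x y x0 x1 P hPr _ (hPb i) M _ hM rfl
    rw [← hw1, ← hw2, ← hEdef] at hb
    have hM1 : 1 ≤ M := le_max_right _ _
    set H := max (max (v i w1) (v i w2)) 1 with hH
    have hH1 : 1 ≤ H := le_max_right _ _
    have hE0 : 0 < v i E := (v i).pos hE
    have hl := Real.log_le_log (by positivity) hb
    rw [Real.log_mul (by positivity) (by positivity), Real.log_mul (by positivity) (by positivity),
      Real.log_mul (by positivity) (by positivity), Real.log_mul (by positivity) (by positivity),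
      Real.log_pow, Real.log_pow, Real.log_pow] at hl
    have hH2 : Real.log H ≤ _ := log_max_one_le (v i w1) (v i w2)
    have l2 : 0 ≤ Real.log 2 := Real.log_nonneg (by norm_num)
    rw [hk] at hl
    push_cast at hl
    have : 0 ≤ N * Real.log 2 := by positivity
    nlinarith
  have hsum : ∑ i, n i * Real.log (v i E) ≤ ∑ i, n i * ((|Real.log (v i w1)| + |Real.log (v i w2)|)
      + 6 * (N + 1) * Real.log 2 - N * Real.log (max (max (v i x) (v i (1 - x))) 1)) := by
    refine Finset.sum_le_sum fun i _ => ?_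
    have := hn i
    have := hloc i
    gcongr
  have e : ∑ i, n i * ((|Real.log (v i w1)| + |Real.log (v i w2)|)
      + 6 * (N + 1) * Real.log 2 - N * Real.log (max (max (v i x) (v i (1 - x))) 1)) =
      (∑ i, n i * (|Real.log (v i w1)| + |Real.log (v i w2)|)) + (∑ i, n i) * (6 * (N + 1) * Real.log 2)
      - N * ∑ i, n i * Real.log (max (max (v i x) (v i (1 - x))) 1) := by
    rw [Finset.mul_sum, Finset.sum_mul, ← Finset.sum_add_distrib, ← Finset.sum_sub_distrib]
    refine Finset.sum_congr rfl fun i _ => ?_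
    ring
  linarith

lemma sum_abs_log_le {K : Type*} [Field K] {ι : Type*} [Fintype ι]
    (v : ι → AbsoluteValue K ℝ) (n : ι → ℝ) (hn : ∀ i, 1 ≤ n i) (O : Subring K)
    (hO : ∀ a ∈ O, a ≠ 0 → 0 ≤ ∑ i, n i * Real.log (v i a))
    (x : K) (hx : x ∈ O) (x0 : x ≠ 0) (M : ι → ℝ) (h1 : ∀ i, 1 ≤ M i) (hM : ∀ i, v i x ≤ M i) (i : ι) :
    |Real.log (v i x)| ≤ 2 * ∑ i, n i * Real.log (M i) := by
  have h := hO _ hx x0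
  have h3 : ∀ j, n j * |Real.log (v j x)| ≤ 2 * (n j * Real.log (M j)) - n j * Real.log (v j x) := by
    intro j
    have a1 : 0 ≤ Real.log (M j) := Real.log_nonneg (h1 j)
    have a2 : Real.log (v j x) ≤ Real.log (M j) := Real.log_le_log ((v j).pos x0) (hM j)
    have a3 := hn j
    rcases abs_cases (Real.log (v j x)) with ⟨h, _⟩ | ⟨h, _⟩ <;> rw [h] <;> nlinarith
  have h4 : |Real.log (v i x)| ≤ ∑ j, n j * |Real.log (v j x)| := by
    calc |Real.log (v i x)| ≤ n i * |Real.log (v i x)| :=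
          le_mul_of_one_le_left (abs_nonneg _) (hn i)
      _ ≤ _ := Finset.single_le_sum (f := fun j => n j * |Real.log (v j x)|)
          (fun j _ => mul_nonneg (by linarith [hn j]) (abs_nonneg _)) (Finset.mem_univ i)
  have h5 : ∑ j, n j * |Real.log (v j x)| ≤ ∑ j, (2 * (n j * Real.log (M j)) - n j * Real.log (v j x)) :=
    Finset.sum_le_sum fun j _ => h3 j
  have h6 : |Real.log (v i x)| ≤ 2 * ∑ i, n i * Real.log (M i) - ∑ i, n i * Real.log (v i x) := by
    refine h4.trans (h5.trans ?_)
    rw [Finset.sum_sub_distrib, Finset.mul_sum]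
  linarith

theorem sunit_abstract {K : Type*} [Field K] [CharZero K] {ι : Type*} [Fintype ι]
    (v : ι → AbsoluteValue K ℝ) (n : ι → ℝ) (hn : ∀ i, 1 ≤ n i) (O : Subring K)
    (hO : ∀ a ∈ O, a ≠ 0 → 0 ≤ ∑ i, n i * Real.log (v i a))
    (hnorth : ∀ B : ℝ, {x : K | x ∈ O ∧ x ≠ 0 ∧ ∀ i, v i x ≤ B}.Finite) :
    {x : K | x ∈ O ∧ x⁻¹ ∈ O ∧ (1 - x)⁻¹ ∈ O ∧ x ≠ 0 ∧ 1 - x ≠ 0}.Finite := by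
  set U := {x : K | x ∈ O ∧ x⁻¹ ∈ O ∧ (1 - x)⁻¹ ∈ O ∧ x ≠ 0 ∧ 1 - x ≠ 0} with hU
  let ℓ : K → (ι → ℝ × ℝ) := fun x i => (Real.log (v i x), Real.log (v i (1 - x)))
  set n0 := ∑ i, n i with hn0
  have hn0' : 0 ≤ n0 := Finset.sum_nonneg fun i _ => by linarith [hn i]
  have hl2 : 0 ≤ Real.log 2 := Real.log_nonneg (by norm_num)
  obtain ⟨B, hB⟩ := bounded_of_gap (ℓ '' U) (2 * (2 * n0 + n0 * 6 * Real.log 2) + 1) (by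
      have : 0 ≤ n0 * 6 * Real.log 2 := by positivity
      linarith) (by
    rintro _ ⟨x, ⟨hx, hx', h1x, x0, x1⟩, rfl⟩ _ ⟨y, ⟨hy, hy', h1y, y0, y1⟩, rfl⟩ N
    have hm := main_ineq v n hn O hO x y hx hx' h1x x0 x1 hy y0 N
    set S := ∑ i, n i * Real.log (max (max (v i x) (v i (1 - x))) 1) with hS
    have hnx : ‖ℓ x‖ ≤ 2 * S := by
      have S0 : 0 ≤ S := Finset.sum_nonneg fun i _ =>
        mul_nonneg (by linarith [hn i]) (Real.log_nonneg (le_max_right _ _))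
      rw [pi_norm_le_iff_of_nonneg (by positivity)]
      intro i
      rw [Prod.norm_def]
      apply max_le
      · exact sum_abs_log_le v n hn O hO x hx x0 _ (fun i => le_max_right _ _)
          (fun i => (le_max_left _ _).trans (le_max_left _ _)) i
      · exact sum_abs_log_le v n hn O hO (1 - x) (sub_mem (one_mem _) hx) x1 _ (fun i => le_max_right _ _)
          (fun i => (le_max_right _ _).trans (le_max_left _ _)) i
    set d := ℓ y - ((2 * N + 1 : ℕ) : ℝ) • ℓ x with hd
    have hw : ∑ i, n i * (|Real.log (v i (y / x ^ (2 * N + 1)))| +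
        |Real.log (v i ((1 - y) / (1 - x) ^ (2 * N + 1)))|) ≤ n0 * (2 * ‖d‖) := by
      rw [hn0, Finset.sum_mul]
      refine Finset.sum_le_sum fun i _ => ?_
      have hi := norm_le_pi_norm d i
      rw [Prod.norm_def] at hi
      have h1 : (d i).1 = Real.log (v i (y / x ^ (2 * N + 1))) := by
        rw [map_div₀, map_pow, Real.log_div ((v i).ne_zero y0) (pow_ne_zero _ ((v i).ne_zero x0)),
          Real.log_pow]
        simp [hd, ℓ]
      have h2 : (d i).2 = Real.log (v i ((1 - y) / (1 - x) ^ (2 * N + 1))) := by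
        rw [map_div₀, map_pow, Real.log_div ((v i).ne_zero y1) (pow_ne_zero _ ((v i).ne_zero x1)),
          Real.log_pow]
        simp [hd, ℓ]
      rw [← h1, ← h2]
      have := (le_max_left _ _).trans hi
      have := (le_max_right _ _).trans hi
      rw [Real.norm_eq_abs] at *
      have := hn i
      have : |(d i).1| + |(d i).2| ≤ 2 * ‖d‖ := by linarith
      gcongr
    have d0 := norm_nonneg d
    have N0 : (0 : ℝ) ≤ N := Nat.cast_nonneg N
    have k1 : N * ‖ℓ x‖ ≤ N * (2 * S) := by gcongr
    have k2 : 0 ≤ n0 * 6 * Real.log 2 := by positivity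
    have k3 : 0 ≤ n0 * 6 * Real.log 2 * ‖d‖ := by positivity
    have k4 : 0 ≤ n0 * N := by positivity
    nlinarith)
  refine (hnorth (Real.exp B)).subset ?_
  intro x hx
  refine ⟨hx.1, hx.2.2.2.1, fun i => ?_⟩
  have h1 := hB _ ⟨x, hx, rfl⟩
  have h2 := (norm_le_pi_norm (ℓ x) i).trans h1
  rw [Prod.norm_def] at h2
  have h3 := (le_max_left _ _).trans h2
  have h4 : Real.log (v i x) ≤ B := (le_abs_self _).trans h3
  rwa [Real.log_le_iff_le_exp ((v i).pos hx.2.2.2.1)] at h4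

end PartD

section PartE
open NumberField

theorem sunit_finite {K : Type*} [Field K] [NumberField K] (S : Finset (FinitePlace K)) :
    {x : K | x ≠ 0 ∧ 1 - x ≠ 0 ∧ ∀ w : FinitePlace K, w ∉ S → w x = 1 ∧ w (1 - x) = 1}.Finite := by
  classical
  let O : Subring K :=
    { carrier := {a | ∀ w : FinitePlace K, w ∉ S → w a ≤ 1}
      mul_mem' := by
        intro a b ha hb w hw
        rw [map_mul]
        exact mul_le_one₀ (ha w hw) (apply_nonneg _ _) (hb w hw)
      one_mem' := by intro w hw; simp
      add_mem' := by
        intro a b ha hb w hw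
        exact (FinitePlace.add_le w a b).trans (max_le (ha w hw) (hb w hw))
      zero_mem' := by intro w hw; simp
      neg_mem' := by
        intro a ha w hw
        rw [map_neg_eq_map]; exact ha w hw }
  let v : InfinitePlace K ⊕ S → AbsoluteValue K ℝ := Sum.elim (fun w => w.1) (fun w => w.1.1)
  let n : InfinitePlace K ⊕ S → ℝ := Sum.elim (fun w => w.mult) (fun _ => 1)
  have hn : ∀ i, 1 ≤ n i := by
    rintro (w | w)
    · have : 1 ≤ w.mult := InfinitePlace.mult_pos
      simp only [n, Sum.elim_inl]; exact_mod_cast this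
    · simp [n]
  have hO : ∀ a ∈ O, a ≠ 0 → 0 ≤ ∑ i, n i * Real.log (v i a) := by
    intro a ha a0
    have hpf := prod_abs_eq_one a0
    have hfin : (Function.mulSupport fun w : FinitePlace K => w a).Finite :=
      FinitePlace.hasFiniteMulSupport a0
    rw [finprod_eq_prod_of_mulSupport_subset (s := hfin.toFinset ∪ S) _ (by
      intro w hw; simp; left; exact hw)] at hpf
    have hle : ∏ w ∈ hfin.toFinset ∪ S, w a ≤ ∏ w ∈ S, w a := by
      rw [← Finset.prod_sdiff (Finset.subset_union_right : S ⊆ hfin.toFinset ∪ S)]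
      refine mul_le_of_le_one_left (Finset.prod_nonneg fun w _ => apply_nonneg _ _) ?_
      refine Finset.prod_le_one (fun w _ => apply_nonneg _ _) fun w hw => ha w ?_
      exact (Finset.mem_sdiff.mp hw).2
    have hpos : 0 < ∏ w : InfinitePlace K, w a ^ w.mult :=
      Finset.prod_pos fun w _ => pow_pos (InfinitePlace.pos_iff.mpr a0) _
    have h1 : 1 ≤ (∏ w : InfinitePlace K, w a ^ w.mult) * ∏ w ∈ S, w a := by
      rw [← hpf]; gcongr
    have h2 := Real.log_nonneg h1
    rw [Real.log_mul hpos.ne' (Finset.prod_ne_zero_iff.mpr fun w _ => (FinitePlace.pos_iff.mpr a0).ne'),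
      Real.log_prod (fun w _ => (pow_pos (InfinitePlace.pos_iff.mpr a0) _).ne'),
      Real.log_prod (fun w _ => (FinitePlace.pos_iff.mpr a0).ne')] at h2
    simp only [Real.log_pow] at h2
    rw [Fintype.sum_sum_type]
    simp only [n, v, Sum.elim_inl, Sum.elim_inr, one_mul]
    rw [Finset.sum_coe_sort S (fun w : FinitePlace K => Real.log (w.1 a))]
    exact h2
  have hnorth : ∀ B : ℝ, {x : K | x ∈ O ∧ x ≠ 0 ∧ ∀ i, v i x ≤ B}.Finite := by
    intro B
    set B' := max B 1 with hB'
    refine (NumberField.finite_setOfPred_mulHeight₁_le K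
      ((∏ v : InfinitePlace K, B' ^ v.mult) * ∏ w ∈ S, B')).subset ?_
    rintro x ⟨hx, x0, hb⟩
    have b1 : (1 : ℝ) ≤ B' := le_max_right _ _
    change Height.mulHeight₁ x ≤ _
    rw [mulHeight₁_eq]
    rw [finprod_eq_prod_of_mulSupport_subset (s := S) _ (by
      intro w hw
      by_contra hwS
      exact hw (max_eq_right (hx w hwS)))]
    have c1 : ∏ v : InfinitePlace K, max (v x) 1 ^ v.mult ≤ ∏ v : InfinitePlace K, B' ^ v.mult := by
      refine Finset.prod_le_prod (fun w _ => by positivity) fun w _ => ?_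
      have : w x ≤ B := hb (Sum.inl w)
      exact pow_le_pow_left₀ (by positivity) (max_le_max this le_rfl) _
    have c2 : ∏ w ∈ S, max (w x) 1 ≤ ∏ w ∈ S, B' := by
      refine Finset.prod_le_prod (fun w _ => by positivity) fun w hw => ?_
      have : w x ≤ B := hb (Sum.inr ⟨w, hw⟩)
      exact max_le_max this le_rfl
    exact mul_le_mul c1 c2 (Finset.prod_nonneg fun w _ => by positivity)
      (Finset.prod_nonneg fun w _ => by positivity)
  refine (sunit_abstract v n hn O hO hnorth).subset ?_
  rintro x ⟨x0, x1, hx⟩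
  refine ⟨fun w hw => (hx w hw).1.le, fun w hw => ?_, fun w hw => ?_, x0, x1⟩
  · rw [map_inv₀, (hx w hw).1, inv_one]
  · rw [map_inv₀, (hx w hw).2, inv_one]

end PartE

section PartF
open NumberField

section F
variable {K : Type*} [Field K] [NumberField K]

/-- places where some nonzero element of a finite set is not a unit -/
lemma exists_S (T : Finset K) : ∃ S : Finset (FinitePlace K), ∀ t ∈ T, t ≠ 0 →
    ∀ w : FinitePlace K, w ∉ S → w t = 1 := by
  classical
  induction T using Finset.induction_on with
  | empty => exact ⟨∅, by simp⟩
  | insert a T ha ih =>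
    obtain ⟨S, hS⟩ := ih
    by_cases h0 : a = 0
    · refine ⟨S, fun t ht t0 => ?_⟩
      rcases Finset.mem_insert.mp ht with rfl | ht
      · exact absurd h0 t0
      · exact hS t ht t0
    · have hfin : (Function.mulSupport fun w : FinitePlace K => w a).Finite :=
        FinitePlace.hasFiniteMulSupport h0
      refine ⟨S ∪ hfin.toFinset, fun t ht t0 w hw => ?_⟩
      simp only [Finset.mem_union, Set.Finite.mem_toFinset, Function.mem_mulSupport, not_or,
        not_not] at hw
      rcases Finset.mem_insert.mp ht with rfl | ht
      · exact hw.2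
      · exact hS t ht t0 w hw.1

lemma w_le {T : Finset K} {S : Finset (FinitePlace K)} (hS : ∀ t ∈ T, t ≠ 0 →
    ∀ w : FinitePlace K, w ∉ S → w t = 1) {t : K} (ht : t ∈ T) {w : FinitePlace K} (hw : w ∉ S) :
    w t ≤ 1 := by
  by_cases h : t = 0
  · simp [h]
  · exact (hS t ht h w hw).le

lemma two_points (S : Finset (FinitePlace K)) (p q : K) (hpq : p ≠ q) :
    {l : K | ∀ w : FinitePlace K, w ∉ S → w (l - p) = 1 ∧ w (l - q) = 1}.Finite := by
  classical
  obtain ⟨S', hS'⟩ := exists_S {q - p}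
  have h0 : q - p ≠ 0 := sub_ne_zero.mpr hpq.symm
  have hfin := sunit_finite (S ∪ S')
  have : Function.Injective (fun l : K => (l - p) / (q - p)) := by
    intro a b hab
    simp only at hab
    field_simp at hab
    simpa using hab
  refine (((hfin.preimage this.injOn)).union (Set.toFinite {p, q})).subset ?_
  intro l hl
  by_cases h1 : l = p
  · right; simp [h1]
  by_cases h2 : l = q
  · right; simp [h2]
  left
  have h1' : l - p ≠ 0 := sub_ne_zero.mpr h1
  have h2' : l - q ≠ 0 := sub_ne_zero.mpr h2
  have e : 1 - (l - p) / (q - p) = - ((l - q) / (q - p)) := by field_simp; ring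
  refine ⟨div_ne_zero h1' h0, by rw [e]; exact neg_ne_zero.mpr (div_ne_zero h2' h0), fun w hw => ?_⟩
  simp only [Finset.mem_union, not_or] at hw
  have hu := hS' (q - p) (by simp) h0 w hw.2
  have := hl w hw.1
  rw [e, map_neg_eq_map, map_div₀, map_div₀, hu, this.1, this.2]
  simp

lemma three_points (S : Finset (FinitePlace K)) (p q r : K) (hpq : p ≠ q) (hpr : p ≠ r)
    (hqr : q ≠ r) :
    {l : K | ∀ w : FinitePlace K, w ∉ S → w (l - p) = w (l - q) ∧ w (l - r) = w (l - q)}.Finite := by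
  classical
  obtain ⟨S', hS'⟩ := exists_S {r - q, r - p, p - q}
  have h1 : r - q ≠ 0 := sub_ne_zero.mpr hqr.symm
  have h2 : r - p ≠ 0 := sub_ne_zero.mpr hpr.symm
  have h3 : p - q ≠ 0 := sub_ne_zero.mpr hpq
  have hfin := sunit_finite (S ∪ S')
  have hinj : Set.InjOn (fun l : K => (l - p) * (r - q) / ((l - q) * (r - p))) {l | l ≠ q} := by
    intro a ha b hb hab
    have ha' : a - q ≠ 0 := sub_ne_zero.mpr ha
    have hb' : b - q ≠ 0 := sub_ne_zero.mpr hb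
    simp only at hab
    field_simp at hab
    have : (a - b) * (p - q) = 0 := by linear_combination hab
    rcases mul_eq_zero.mp this with h | h
    · exact sub_eq_zero.mp h
    · exact absurd h h3
  refine (((hfin.preimage (hinj.mono ?_))).union (Set.toFinite {p, q, r})).subset ?_
  · rintro l ⟨hl, -⟩ rfl
    simp at hl
  intro l hl
  by_cases k1 : l = p
  · right; simp [k1]
  by_cases k2 : l = q
  · right; simp [k2]
  by_cases k3 : l = r
  · right; simp [k3]
  left
  have k1' : l - p ≠ 0 := sub_ne_zero.mpr k1
  have k2' : l - q ≠ 0 := sub_ne_zero.mpr k2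
  have k3' : l - r ≠ 0 := sub_ne_zero.mpr k3
  have e : 1 - (l - p) * (r - q) / ((l - q) * (r - p)) = -((l - r) * (p - q)) / ((l - q) * (r - p)) := by
    field_simp; ring
  refine ⟨div_ne_zero (mul_ne_zero k1' h1) (mul_ne_zero k2' h2),
    by rw [e]; exact div_ne_zero (neg_ne_zero.mpr (mul_ne_zero k3' h3)) (mul_ne_zero k2' h2), fun w hw => ?_⟩
  simp only [Finset.mem_union, not_or] at hw
  have u1 := hS' (r - q) (by simp) h1 w hw.2
  have u2 := hS' (r - p) (by simp) h2 w hw.2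
  have u3 := hS' (p - q) (by simp) h3 w hw.2
  obtain ⟨v1, v2⟩ := hl w hw.1
  have v0 : w (l - q) ≠ 0 := (FinitePlace.pos_iff.mpr k2').ne'
  rw [e]
  simp only [map_div₀, map_neg_eq_map, map_mul, u1, u2, u3, v1, v2, mul_one, div_self v0, and_self]

open Polynomial

/-- evaluation of an integral polynomial at an integral point -/
lemma eval_le_one (w : FinitePlace K) (h : K[X]) (hh : ∀ i, w (h.coeff i) ≤ 1) (x : K)
    (hx : w x ≤ 1) : w (h.eval x) ≤ 1 := by
  rw [eval_eq_sum_range]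
  refine Finset.sum_induction _ (fun y => w y ≤ 1) (fun a b ha hb =>
    (FinitePlace.add_le w a b).trans (max_le ha hb)) (by simp) fun i _ => ?_
  rw [map_mul, map_pow]
  exact mul_le_one₀ (hh i) (pow_nonneg (apply_nonneg _ _) _) (pow_le_one₀ (apply_nonneg _ _) hx)

lemma w_sub_le (w : FinitePlace K) (a b : K) : w (a - b) ≤ max (w a) (w b) := by
  rw [sub_eq_add_neg]
  refine (FinitePlace.add_le w _ _).trans ?_
  rw [map_neg_eq_map]

/-- ultrametric: if `w a < w b` then `w (a+b) = w b` -/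
lemma w_add_eq (w : FinitePlace K) (a b : K) (h : w a < w b) : w (a + b) = w b := by
  apply le_antisymm
  · exact (FinitePlace.add_le w a b).trans (max_le h.le le_rfl)
  · by_contra! hlt
    have : w b ≤ max (w (a + b)) (w a) := by
      have := w_sub_le w (a + b) a
      simpa using this
    exact absurd (this.trans_lt (max_lt hlt h)) (lt_irrefl _)

lemma root_punct (w : FinitePlace K) (h : K[X]) (r : K) (hr : h.IsRoot r)
    (hq : ∀ i, w ((h /ₘ (X - C r)).coeff i) ≤ 1) (l : K) (hl : w l ≤ 1) (hr1 : w r ≤ 1)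
    (hu : w (h.eval l) = 1) : w (l - r) = 1 := by
  apply le_antisymm ((w_sub_le w l r).trans (max_le hl hr1))
  have e : (X - C r) * (h /ₘ (X - C r)) = h := mul_divByMonic_eq_iff_isRoot.mpr hr
  have : w (l - r) * w ((h /ₘ (X - C r)).eval l) = 1 := by
    rw [← map_mul, ← hu]
    conv_rhs => rw [← e]
    simp
  have h2 := eval_le_one w _ hq l hl
  rw [← this]
  exact mul_le_of_le_one_right (apply_nonneg _ _) h2

/-- a large point has large value -/
lemma int_of_deg (w : FinitePlace K) (c : K[X]) (hd : 2 ≤ c.natDegree)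
    (hc : ∀ i, w (c.coeff i) ≤ 1) (hlc : w c.leadingCoeff = 1) (l : K)
    (h : w (c.eval l) = w l) : w l ≤ 1 := by
  by_contra! hl
  have h2 : w (c.eval l) = w l ^ c.natDegree := by
    rw [eval_eq_sum_range, Finset.sum_range_succ]
    have e : w (c.coeff c.natDegree * l ^ c.natDegree) = w l ^ c.natDegree := by
      rw [map_mul, map_pow, coeff_natDegree, hlc, one_mul]
    rw [← e]
    apply w_add_eq
    rw [e]
    have : w (∑ x ∈ Finset.range c.natDegree, c.coeff x * l ^ x) ≤ w l ^ (c.natDegree - 1) := by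
      refine Finset.sum_induction _ (fun y => w y ≤ w l ^ (c.natDegree - 1)) (fun a b ha hb =>
        (FinitePlace.add_le w a b).trans (max_le ha hb)) (by simp) fun i hi => ?_
      rw [map_mul, map_pow]
      refine (mul_le_of_le_one_left (by positivity) (hc i)).trans ?_
      refine pow_le_pow_right₀ hl.le ?_
      have := Finset.mem_range.mp hi
      omega
    refine this.trans_lt (pow_lt_pow_right₀ hl (by omega))
  have h3 : w l ^ 1 < w l ^ c.natDegree := pow_lt_pow_right₀ hl (by omega)
  rw [pow_one, ← h2, h] at h3
  exact lt_irrefl _ h3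
end F

end PartF

section PartG
open NumberField
open Polynomial

section G
variable {K : Type*} [Field K] [NumberField K]

lemma exists_S_poly (T : Finset K) (P : Finset K[X]) : ∃ S : Finset (FinitePlace K),
    ∀ w : FinitePlace K, w ∉ S → (∀ t ∈ T, t ≠ 0 → w t = 1) ∧ (∀ t ∈ T, w t ≤ 1) ∧
      ∀ h ∈ P, ∀ i, w (h.coeff i) ≤ 1 := by
  classical
  obtain ⟨S, hS⟩ := exists_S (T ∪ P.biUnion fun h => h.support.image h.coeff)
  refine ⟨S, fun w hw => ⟨fun t ht t0 => hS t (Finset.mem_union_left _ ht) t0 w hw,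
    fun t ht => w_le hS (Finset.mem_union_left _ ht) hw, fun h hh i => ?_⟩⟩
  by_cases h0 : h.coeff i = 0
  · simp [h0]
  · refine w_le hS (Finset.mem_union_right _ ?_) hw
    rw [Finset.mem_biUnion]
    exact ⟨h, hh, Finset.mem_image.mpr ⟨i, mem_support_iff.mpr h0, rfl⟩⟩

/-- Case A: degree at least two, nonzero constant term -/
lemma caseA (α : K) (hα : α ≠ 0) (c : K[X]) (hd : 2 ≤ c.natDegree) (h0 : c.eval 0 ≠ 0)
    (r : K) (hr : c.IsRoot r) : {l : K | ∃ m : ℕ, α ^ m * l = c.eval l}.Finite := by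
  classical
  have r0 : r ≠ 0 := by rintro rfl; exact h0 hr
  have c0 : c ≠ 0 := by rintro rfl; simp at hd
  obtain ⟨S, hS⟩ := exists_S_poly {α, c.eval 0, c.leadingCoeff, r} {c, c.divX, c /ₘ (X - C r)}
  refine (two_points S 0 r r0.symm).subset ?_
  rintro l ⟨m, hm⟩ w hw
  obtain ⟨h1, h1', h2⟩ := hS w hw
  have uα := h1 α (by simp) hα
  have e1 : w (c.eval l) = w l := by rw [← hm, map_mul, map_pow, uα]; simp
  have hl : w l ≤ 1 := int_of_deg w c hd (h2 c (by simp))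
    (h1 _ (by simp) (leadingCoeff_ne_zero.mpr c0)) l e1
  have e2 : w l = 1 := by
    apply le_antisymm hl
    by_contra! hlt
    have e3 : c.eval l = l * c.divX.eval l + c.eval 0 := by
      conv_lhs => rw [← divX_mul_X_add c]
      simp [coeff_zero_eq_eval_zero]; ring
    have e4 : w (c.eval l) = 1 := by
      rw [e3, w_add_eq, h1 _ (by simp) h0]
      rw [h1 _ (by simp) h0, map_mul]
      refine (mul_le_of_le_one_right (apply_nonneg _ _) ?_).trans_lt hlt
      exact eval_le_one w _ (h2 _ (by simp)) l hl
    rw [e1] at e4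
    exact hlt.ne e4
  refine ⟨by simpa using e2, ?_⟩
  exact root_punct w c r hr (h2 _ (by simp)) l hl (h1' r (by simp)) (by rw [e1, e2])

/-- Case C: degree at least two, `c = X * e`, and a similar factorization at one -/
lemma caseC (α δ : K) (hα : α ≠ 0) (hδ : δ ≠ 0) (c e e' : K[X]) (hd : 2 ≤ c.natDegree)
    (he : c = X * e) (he' : c = (X - C 1) * e' + C 1) (r s : K) (hr : e.IsRoot r)
    (hs : e'.IsRoot s) :
    {l : K | ∃ m n : ℕ, α ^ m * l = c.eval l ∧ δ ^ n * (l - 1) + 1 = c.eval l}.Finite := by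
  classical
  have c0 : c ≠ 0 := by rintro rfl; simp at hd
  have hrs : r ≠ s := by
    rintro rfl
    have h1 : c.eval r = 0 := by rw [he]; simp [hr.eq_zero]
    have h2 : c.eval r = 1 := by rw [he']; simp [hs.eq_zero]
    exact zero_ne_one (h1.symm.trans h2)
  obtain ⟨S, hS⟩ := exists_S_poly {α, δ, c.leadingCoeff, r, s} {c, e /ₘ (X - C r), e' /ₘ (X - C s)}
  refine ((two_points S r s hrs).union (Set.toFinite {0, 1})).subset ?_
  rintro l ⟨m, n, hm, hn⟩
  by_cases l0 : l = 0
  · right; simp [l0]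
  by_cases l1 : l = 1
  · right; simp [l1]
  left
  intro w hw
  obtain ⟨h1, h1', h2⟩ := hS w hw
  have uα := h1 α (by simp) hα
  have uδ := h1 δ (by simp) hδ
  have e1 : w (c.eval l) = w l := by rw [← hm, map_mul, map_pow, uα]; simp
  have hl : w l ≤ 1 := int_of_deg w c hd (h2 c (by simp))
    (h1 _ (by simp) (leadingCoeff_ne_zero.mpr c0)) l e1
  have ev1 : e.eval l = α ^ m := by
    rw [he] at hm
    simp only [eval_mul, eval_X] at hm
    exact (mul_left_cancel₀ l0 (by linear_combination hm)).symm
  have ev2 : e'.eval l = δ ^ n := by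
    rw [he'] at hn
    simp only [eval_mul, eval_X, eval_sub, eval_C, eval_add] at hn
    exact (mul_left_cancel₀ (sub_ne_zero.mpr l1) (by linear_combination hn)).symm
  exact ⟨root_punct w e r hr (h2 _ (by simp)) l hl (h1' r (by simp)) (by rw [ev1, map_pow, uα, one_pow]),
    root_punct w e' s hs (h2 _ (by simp)) l hl (h1' s (by simp)) (by rw [ev2, map_pow, uδ, one_pow])⟩

/-- Case of degree at most one -/
lemma caseL (α δ : K) (hα : α ≠ 0) (hδ : δ ≠ 0) (a b : K) (hb : b ≠ 0) (hab : a + b ≠ 1)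
    (hex : ¬ (a = -1 ∧ b = 1)) :
    {l : K | ∃ m n : ℕ, α ^ m * l = a * l + b ∧ δ ^ n * (l - 1) + 1 = a * l + b}.Finite := by
  classical
  have hab' : a + b - 1 ≠ 0 := sub_ne_zero.mpr hab
  obtain ⟨S, hS⟩ := exists_S_poly {α, δ, a, b, a + b - 1} (∅ : Finset K[X])
  have key : ∀ l : K, (∃ m n : ℕ, α ^ m * l = a * l + b ∧ δ ^ n * (l - 1) + 1 = a * l + b) →
      ∀ w : FinitePlace K, w ∉ S → w l = w (a * l + b) ∧ w (l - 1) = w (a * (l - 1) + (a + b - 1)) := by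
    rintro l ⟨m, n, hm, hn⟩ w hw
    obtain ⟨h1, h1', h2⟩ := hS w hw
    rw [← hm, show a * (l - 1) + (a + b - 1) = δ ^ n * (l - 1) by linear_combination -hn]
    simp [h1 α (by simp) hα, h1 δ (by simp) hδ]
  by_cases a0 : a = 0
  · subst a0
    refine (two_points S 0 1 zero_ne_one).subset ?_
    intro l hl w hw
    obtain ⟨h1, h1', h2⟩ := hS w hw
    have := key l hl w hw
    simp only [zero_mul, zero_add] at this
    rw [sub_zero, this.1, this.2]
    exact ⟨h1 _ (by simp) hb, h1 (b - 1) (by simp) (by simpa using hab')⟩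
  by_cases hs : a + b = 0
  · have a1 : a ≠ -1 := fun h => hex ⟨h, by linear_combination hs - h⟩
    have hbb : b = -a := by linear_combination hs
    refine (three_points S 0 1 (1 + 1 / a) zero_ne_one ?_ ?_).subset ?_
    · intro h; apply a1; field_simp at h; linear_combination -h
    · intro h; field_simp at h; simp at h
    · intro l hl w hw
      obtain ⟨h1, h1', h2⟩ := hS w hw
      have ua := h1 a (by simp) a0
      obtain ⟨k1, k2⟩ := key l hl w hw
      rw [hbb, show a * l + -a = a * (l - 1) by ring, map_mul, ua, one_mul] at k1
      rw [show a * (l - 1) + (a + b - 1) = a * (l - (1 + 1 / a)) by rw [hs]; field_simp; ring,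
        map_mul, ua, one_mul] at k2
      exact ⟨by simpa using k1, k2.symm⟩
  · refine (three_points S 1 0 (-b / a) one_ne_zero ?_ ?_).subset ?_
    · intro h; apply hs; field_simp at h; linear_combination h
    · intro h; field_simp at h; apply hb; linear_combination h
    · intro l hl w hw
      obtain ⟨h1, h1', h2⟩ := hS w hw
      have ua := h1 a (by simp) a0
      have ub := h1 b (by simp) hb
      have uc := h1 (a + b - 1) (by simp) hab'
      obtain ⟨k1, k2⟩ := key l hl w hw
      have k3 := k1
      rw [show a * l + b = a * (l - (- b / a)) by field_simp; ring, map_mul, ua, one_mul] at k3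
      rw [sub_zero]
      refine ⟨?_, k3.symm⟩
      rcases lt_trichotomy (w l) 1 with h | h | h
      · exfalso
        rw [w_add_eq w (a * l) b (by rw [map_mul, ua, ub, one_mul]; exact h), ub] at k1
        exact h.ne k1
      · rw [h]
        have hle : w (l - 1) ≤ 1 := (w_sub_le w l 1).trans (by rw [h]; simp)
        by_contra hne
        have hlt := lt_of_le_of_ne hle hne
        rw [w_add_eq w _ _ (by rw [map_mul, ua, uc, one_mul]; exact hlt), uc] at k2
        exact hne k2
      · rw [sub_eq_add_neg, add_comm, w_add_eq]
        rw [map_neg_eq_map, map_one]; exact h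
end G

end PartG

section PartH
open NumberField
open Polynomial

section H
variable {K : Type*} [Field K] [NumberField K]

lemma nf_split (α δ : K) (hα : α ≠ 0) (hδ : δ ≠ 0) (c : K[X]) (hd : 2 ≤ c.natDegree)
    (hsp : (c * (c - 1)).Splits) :
    {l : K | ∃ m n : ℕ, α ^ m * l = c.eval l ∧ δ ^ n * (l - 1) + 1 = c.eval l}.Finite := by
  have hd1 : (c - 1).natDegree = c.natDegree := by
    rw [← C_1]; exact natDegree_sub_C
  have c0 : c ≠ 0 := by rintro rfl; simp at hd
  have c1 : c - 1 ≠ 0 := by intro h; rw [h] at hd1; simp at hd1; omega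
  have hroot : ∀ h : K[X], h ∣ c * (c - 1) → h.natDegree ≠ 0 → ∃ r, h.IsRoot r := by
    intro h hh hd
    exact Splits.exists_eval_eq_zero (hsp.of_dvd (mul_ne_zero c0 c1) hh)
      (fun h0 => hd (natDegree_eq_of_degree_eq_some h0))
  by_cases h0 : c.eval 0 = 0
  · by_cases h1 : c.eval 1 = 1
    · obtain ⟨e, he⟩ : X ∣ c := by rw [X_dvd_iff, coeff_zero_eq_eval_zero]; exact h0
      obtain ⟨e', he'⟩ : (X - C 1) ∣ c - 1 := by
        rw [dvd_iff_isRoot]; simp [h1]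
      have e0 : e ≠ 0 := by rintro rfl; simp at he; exact c0 he
      have e0' : e' ≠ 0 := by rintro rfl; simp at he'; exact c1 he'
      have d1 : e.natDegree ≠ 0 := by
        have := congrArg natDegree he
        rw [natDegree_mul X_ne_zero e0, natDegree_X] at this
        omega
      have d2 : e'.natDegree ≠ 0 := by
        have := congrArg natDegree he'
        rw [natDegree_mul (X_sub_C_ne_zero 1) e0', natDegree_X_sub_C] at this
        omega
      obtain ⟨r, hr⟩ := hroot e (dvd_mul_of_dvd_left ⟨X, by rw [he, mul_comm]⟩ _) d1
      obtain ⟨s, hs⟩ := hroot e' (dvd_mul_of_dvd_right ⟨X - C 1, by rw [he', mul_comm]⟩ _) d2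
      exact caseC α δ hα hδ c e e' hd he (by rw [← he', C_1]; ring) r s hr hs
    · set c' : K[X] := 1 - c.comp (1 - X) with hc'
      have hdc : (c.comp (1 - X)).natDegree = c.natDegree := by
        rw [natDegree_comp, show (1 - X : K[X]) = - (X - C 1) by simp, natDegree_neg,
          natDegree_X_sub_C, mul_one]
      have hd' : c'.natDegree = c.natDegree := by
        rw [hc', ← neg_sub, natDegree_neg, ← C_1, natDegree_sub_C, C_1, hdc]
      obtain ⟨s, hs⟩ := hroot (c - 1) (dvd_mul_left _ _) (by omega)
      have := caseA δ hδ c' (by omega) (by simpa [hc', sub_eq_zero] using fun h => h1 h.symm) (1 - s)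
        (by simp [hc'] at hs ⊢; linear_combination -hs)
      refine (this.preimage (f := fun l : K => 1 - l) (fun a _ b _ h => by simpa using h)).subset ?_
      rintro l ⟨m, n, hm, hn⟩
      refine ⟨n, ?_⟩
      simp [hc']
      linear_combination -hn
  · obtain ⟨r, hr⟩ := hroot c (dvd_mul_right _ _) (by omega)
    refine (caseA α hα c hd h0 r hr).subset ?_
    rintro l ⟨m, n, hm, hn⟩
    exact ⟨m, hm⟩

/-- main theorem over number fields -/
theorem nf_main (α δ : K) (hα : α ≠ 0) (hδ : δ ≠ 0) (c : K[X]) (hd : 2 ≤ c.natDegree) :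
    {l : K | ∃ m n : ℕ, α ^ m * l = c.eval l ∧ δ ^ n * (l - 1) + 1 = c.eval l}.Finite := by
  let L := (c * (c - 1)).SplittingField
  haveI : NumberField L := NumberField.of_module_finite K L
  have hsp := SplittingField.splits (c * (c - 1))
  let φ := algebraMap K L
  have hφ : Function.Injective φ := φ.injective
  have := nf_split (φ α) (φ δ) (by simpa using hα) (by simpa using hδ) (c.map φ)
    (by rw [natDegree_map]; exact hd) (by simpa using hsp)
  refine (this.preimage hφ.injOn).subset ?_
  rintro l ⟨m, n, hm, hn⟩
  refine ⟨m, n, ?_, ?_⟩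
  · rw [eval_map_apply, ← hm]; simp
  · rw [eval_map_apply, ← hn]; simp
end H

end PartH

section PartI
open Polynomial

section I

lemma root_unity_bound {K : Type*} [Field K] [CharZero K] [Module.Finite ℚ K] (D : ℕ)
    (hD : Module.finrank ℚ K ≤ D) (z : K) (k : ℕ) (hk : 1 ≤ k) (hz : z ^ k = 1) :
    z ^ (2 * D).factorial = 1 := by
  have hN : 0 < orderOf z := orderOf_pos_iff.mpr (isOfFinOrder_iff_pow_eq_one.mpr ⟨k, hk, hz⟩)
  have hp : IsPrimitiveRoot z (orderOf z) := IsPrimitiveRoot.orderOf z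
  rw [← orderOf_dvd_iff_pow_eq_one]
  have hdeg : (orderOf z).totient ≤ D := by
    rw [← natDegree_cyclotomic (orderOf z) ℚ, cyclotomic_eq_minpoly_rat hp hN]
    exact (minpoly.natDegree_le z).trans hD
  rw [Nat.dvd_iff_prime_pow_dvd_dvd]
  intro p j pp hpj
  rcases Nat.eq_zero_or_pos j with rfl | hj
  · simp
  apply Nat.dvd_factorial (pow_pos pp.pos _)
  have h1 : (p ^ j).totient ≤ D :=
    (Nat.le_of_dvd (Nat.totient_pos.mpr hN) (Nat.totient_dvd_of_dvd hpj)).trans hdeg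
  rw [Nat.totient_prime_pow pp hj] at h1
  obtain ⟨i, rfl⟩ : ∃ i, j = i + 1 := ⟨j - 1, by omega⟩
  simp only [add_tsub_cancel_right] at h1
  have h2 : p ≤ 2 * (p - 1) := by have := pp.two_le; omega
  calc p ^ (i + 1) = p ^ i * p := pow_succ _ _
    _ ≤ p ^ i * (2 * (p - 1)) := by gcongr
    _ = 2 * (p ^ i * (p - 1)) := by ring
    _ ≤ 2 * D := by gcongr

lemma spec_aux {A : Type} [CommRing A] [IsDomain A] (s : ℕ) [Algebra (MvPolynomial (Fin s) ℚ) A]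
    [Module.Finite (MvPolynomial (Fin s) ℚ) A]
    (hinj : Function.Injective (algebraMap (MvPolynomial (Fin s) ℚ) A)) :
    ∃ D : ℕ, ∀ t : A, t ≠ 0 → ∃ (K : Type) (_ : Field K) (_ : Algebra ℚ K) (φ : A →+* K),
      Module.Finite ℚ K ∧ Module.finrank ℚ K ≤ D ∧ φ t ≠ 0 := by
  classical
  set P := MvPolynomial (Fin s) ℚ
  obtain ⟨G, hG⟩ := (Module.Finite.fg_top : (⊤ : Submodule P A).FG)
  refine ⟨G.card, fun t ht => ?_⟩
  have hb := Ideal.comap_ne_bot_of_integral_mem (R := P) ht (Ideal.mem_span_singleton_self t)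
    (Algebra.IsIntegral.isIntegral t)
  obtain ⟨q, hq, q0⟩ := Submodule.exists_mem_ne_zero_of_ne_bot hb
  obtain ⟨x, hx⟩ : ∃ x : Fin s → ℚ, MvPolynomial.eval x q ≠ 0 := by
    by_contra! h
    exact q0 (MvPolynomial.funext (by simpa using h))
  let ev : P →+* ℚ := MvPolynomial.eval x
  have hsurj : Function.Surjective ev := fun r => ⟨MvPolynomial.C r, MvPolynomial.eval_C r⟩
  have hmax : (RingHom.ker ev).IsMaximal := RingHom.ker_isMaximal_of_surjective ev hsurj
  obtain ⟨Q, hQ, hQP⟩ := Ideal.exists_ideal_over_maximal_of_isIntegral (S := A) (RingHom.ker ev)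
    (by rw [(RingHom.injective_iff_ker_eq_bot _).mp hinj]; exact bot_le)
  let _ : Field (A ⧸ Q) := Ideal.Quotient.field Q
  let ι : ℚ →+* A ⧸ Q := (Ideal.Quotient.mk Q).comp ((algebraMap P A).comp MvPolynomial.C)
  let _ : Algebra ℚ (A ⧸ Q) := ι.toAlgebra
  have hev : ∀ p : P, Ideal.Quotient.mk Q (algebraMap P A p) = ι (ev p) := by
    intro p
    simp only [ι, RingHom.comp_apply]
    rw [Ideal.Quotient.eq, ← map_sub]
    change _ ∈ Q.comap (algebraMap P A)
    rw [hQP, RingHom.mem_ker, map_sub, sub_eq_zero]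
    exact (MvPolynomial.eval_C _).symm
  have hspan : Submodule.span ℚ (((G.image (Ideal.Quotient.mk Q) : Finset (A ⧸ Q))) : Set (A ⧸ Q)) = ⊤ := by
    rw [eq_top_iff]
    rintro y -
    obtain ⟨a, rfl⟩ := Ideal.Quotient.mk_surjective y
    have ha : a ∈ Submodule.span P (G : Set A) := by rw [hG]; trivial
    induction ha using Submodule.span_induction with
    | mem a ha => exact Submodule.subset_span (by simpa using ⟨a, ha, rfl⟩)
    | zero => simp
    | add a b _ _ h1 h2 => rw [map_add]; exact Submodule.add_mem _ h1 h2
    | smul p a _ h =>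
      rw [Algebra.smul_def, map_mul, hev]
      exact Submodule.smul_mem _ (ev p) h
  refine ⟨A ⧸ Q, inferInstance, inferInstance, Ideal.Quotient.mk Q, ?_, ?_, ?_⟩
  · exact ⟨⟨_, hspan⟩⟩
  · have := finrank_span_finset_le_card (R := ℚ) (G.image (Ideal.Quotient.mk Q))
    rw [Set.finrank, hspan, finrank_top] at this
    exact this.trans Finset.card_image_le
  · intro h
    obtain ⟨b, hb⟩ := Ideal.mem_span_singleton.mp (show algebraMap P A q ∈ _ from hq)
    have := hev q
    rw [hb, map_mul, h, zero_mul] at this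
    exact hx ((map_eq_zero ι).mp this.symm)

/-- specialization to number fields -/
theorem spec_nf {A : Type} [CommRing A] [IsDomain A] [Algebra ℚ A] [Algebra.FiniteType ℚ A]
    (α δ t : A) (ht : t ≠ 0) (hα : ∀ k : ℕ, 1 ≤ k → α ^ k ≠ 1) (hδ : ∀ k : ℕ, 1 ≤ k → δ ^ k ≠ 1) :
    ∃ (K : Type) (_ : Field K) (_ : NumberField K) (φ : A →+* K), φ t ≠ 0 ∧
      (∀ k : ℕ, 1 ≤ k → φ α ^ k ≠ 1) ∧ (∀ k : ℕ, 1 ≤ k → φ δ ^ k ≠ 1) := by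
  obtain ⟨s, g, hg, hfin⟩ := exists_finite_inj_algHom_of_fg ℚ A
  let _ : Algebra (MvPolynomial (Fin s) ℚ) A := g.toRingHom.toAlgebra
  have : Module.Finite (MvPolynomial (Fin s) ℚ) A := hfin
  obtain ⟨D, hD⟩ := spec_aux (A := A) s hg
  obtain ⟨K, i1, i2, φ, h1, h2, h3⟩ := hD
    (t * (α ^ (2 * D).factorial - 1) * (δ ^ (2 * D).factorial - 1))
    (mul_ne_zero (mul_ne_zero ht (sub_ne_zero.mpr (hα _ (Nat.factorial_pos _))))
      (sub_ne_zero.mpr (hδ _ (Nat.factorial_pos _))))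
  have i3 : CharZero K := algebraRat.charZero K
  simp only [map_mul, map_sub, map_pow, map_one, mul_ne_zero_iff, sub_ne_zero] at h3
  obtain rfl : i2 = DivisionRing.toRatAlgebra := Subsingleton.elim _ _
  refine ⟨K, i1, { to_charZero := i3, to_finiteDimensional := h1 }, φ, h3.1.1, fun k hk h => h3.1.2 ?_, fun k hk h => h3.2 ?_⟩
  · exact root_unity_bound D h2 _ k hk h
  · exact root_unity_bound D h2 _ k hk h
end I

end PartI

section PartJ
open Polynomial

section J

lemma pow_mul_eq_finite {K : Type*} [Field K] (x y z : K) (hx0 : x ≠ 0)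
    (hx : ∀ k : ℕ, 1 ≤ k → x ^ k ≠ 1) (hy : y ≠ 0) : {m : ℕ | x ^ m * y = z}.Finite := by
  apply Set.Subsingleton.finite
  have key : ∀ a b : ℕ, a < b → x ^ a * y = z → x ^ b * y = z → False := by
    intro a b hab ha hb
    apply hx (b - a) (by omega)
    have h1 : x ^ a * y = x ^ b * y := ha.trans hb.symm
    have h2 : x ^ a = x ^ b := mul_right_cancel₀ hy h1
    rw [show b = a + (b - a) by omega, pow_add] at h2
    have h3 : x ^ a ≠ 0 := pow_ne_zero _ hx0
    have h4 : x ^ a * 1 = x ^ a * x ^ (b - a) := by rw [mul_one]; exact h2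
    exact (mul_left_cancel₀ h3 h4).symm
  intro a ha b hb
  rcases lt_trichotomy a b with h | h | h
  · exact (key a b h ha hb).elim
  · exact h
  · exact (key b a h hb ha).elim

variable {A : Type} [CommRing A] [IsDomain A] [Algebra ℚ A] [Algebra.FiniteType ℚ A]

lemma transfer_deg (ι : A →+* ℂ) (hι : Function.Injective ι) (α δ : A) (hα : α ≠ 0) (hδ : δ ≠ 0)
    (hα1 : ∀ k : ℕ, 1 ≤ k → α ^ k ≠ 1) (hδ1 : ∀ k : ℕ, 1 ≤ k → δ ^ k ≠ 1)
    (c : A[X]) (hd : 2 ≤ c.natDegree) :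
    {l : ℂ | ∃ m n : ℕ, 1 ≤ m ∧ 1 ≤ n ∧ ι α ^ m * l = (c.map ι).eval l ∧
      ι δ ^ n * (l - 1) + 1 = (c.map ι).eval l}.Finite := by
  have c0 : c ≠ 0 := by rintro rfl; simp at hd
  have lc0 : c.leadingCoeff ≠ 0 := leadingCoeff_ne_zero.mpr c0
  obtain ⟨K, iK, iN, φ, ht, hφα, hφδ⟩ := spec_nf α δ (α * δ * c.leadingCoeff)
    (mul_ne_zero (mul_ne_zero hα hδ) lc0) hα1 hδ1
  simp only [map_mul, mul_ne_zero_iff] at ht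
  obtain ⟨⟨a0, d0⟩, l0⟩ := ht
  have hdeg : (c.map φ).natDegree = c.natDegree := natDegree_map_of_leadingCoeff_ne_zero φ l0
  have hfin := nf_main (φ α) (φ δ) a0 d0 (c.map φ) (by omega)
  have hMfin : {m : ℕ | ∃ (l : ℂ) (n : ℕ), 1 ≤ m ∧ 1 ≤ n ∧ ι α ^ m * l = (c.map ι).eval l ∧
      ι δ ^ n * (l - 1) + 1 = (c.map ι).eval l}.Finite := by
    refine ((hfin.inter_of_left {l | l ≠ 0}).biUnion (t := fun l => {m : ℕ | φ α ^ m * l = (c.map φ).eval l})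
      fun l hl => pow_mul_eq_finite _ _ _ a0 hφα hl.2).subset ?_
    rintro m ⟨l, n, hm, hn, e1, e2⟩
    set u := α ^ m with hu
    set v := δ ^ n with hv
    have hv1 : v ≠ 1 := hδ1 n hn
    have e3 : ι (u - v) * l = ι (1 - v) := by
      simp only [map_sub, map_one, hu, hv, map_pow]; linear_combination e1 - e2
    have key : eval (1 - v) (c.scaleRoots (u - v)) = (u - v) ^ (c.natDegree - 1) * (u * (1 - v)) := by
      apply hι
      rw [← eval₂_at_apply, ← e3, scaleRoots_eval₂_mul, ← eval_map, ← e1]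
      simp only [map_mul, map_pow]
      rw [← e3, hu, map_pow]
      obtain ⟨j, hj⟩ : ∃ j, c.natDegree = j + 1 := ⟨c.natDegree - 1, by omega⟩
      rw [hj, Nat.add_sub_cancel]; ring
    have key' := congrArg φ key
    rw [← eval_map_apply, map_scaleRoots _ _ _ l0] at key'
    simp only [map_mul, map_pow, map_sub, map_one] at key'
    have hv1' : 1 - φ v ≠ 0 := sub_ne_zero.mpr (by rw [hv, map_pow]; exact (hφδ n hn).symm)
    have huv : φ u - φ v ≠ 0 := by
      intro h
      rw [h, scaleRoots_zero, zero_pow (by omega), zero_mul, leadingCoeff_map_of_leadingCoeff_ne_zero _ l0] at key'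
      simp only [eval_smul, eval_pow, eval_X, smul_eq_mul] at key'
      exact mul_ne_zero l0 (pow_ne_zero _ hv1') key'
    set l' := (1 - φ v) / (φ u - φ v) with hl'
    have e4 : (φ u - φ v) * l' = 1 - φ v := by rw [hl']; field_simp
    have e5 : φ u * l' = (c.map φ).eval l' := by
      rw [← e4, scaleRoots_eval_mul, hdeg] at key'
      obtain ⟨j, hj⟩ : ∃ j, c.natDegree = j + 1 := ⟨c.natDegree - 1, by omega⟩
      rw [hj, Nat.add_sub_cancel] at key'
      refine mul_left_cancel₀ (pow_ne_zero (j + 1) huv) ?_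
      rw [key']; ring
    rw [Set.mem_iUnion₂]
    refine ⟨l', ⟨⟨m, n, ?_, ?_⟩, ?_⟩, ?_⟩
    · rw [← map_pow]; exact e5
    · rw [← map_pow, ← e5]; linear_combination -e4
    · exact div_ne_zero hv1' huv
    · change φ α ^ m * l' = _
      rw [← map_pow]; exact e5
  refine (hMfin.biUnion (t := fun m => {l : ℂ | (c.map ι - C (ι α ^ m) * X).IsRoot l})
    fun m _ => finite_setOfPred_isRoot ?_).subset ?_
  · intro h
    have := congrArg (fun p => p.coeff c.natDegree) h
    simp only [coeff_sub, coeff_map, coeff_C_mul, coeff_X, coeff_zero, coeff_natDegree] at this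
    rw [if_neg (by omega), mul_zero, sub_zero] at this
    exact lc0 (hι (by rw [this, map_zero]))
  · rintro l ⟨m, n, hm, hn, e1, e2⟩
    rw [Set.mem_iUnion₂]
    refine ⟨m, ⟨l, n, hm, hn, e1, e2⟩, ?_⟩
    simp [e1]

lemma transfer_lin (ι : A →+* ℂ) (hι : Function.Injective ι) (α δ : A) (hα : α ≠ 0) (hδ : δ ≠ 0)
    (hα1 : ∀ k : ℕ, 1 ≤ k → α ^ k ≠ 1) (hδ1 : ∀ k : ℕ, 1 ≤ k → δ ^ k ≠ 1)
    (a b : A) (hb : b ≠ 0) (hab : a + b ≠ 1) (hex : ¬ (a = -1 ∧ b = 1)) :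
    {l : ℂ | ∃ m n : ℕ, 1 ≤ m ∧ 1 ≤ n ∧ ι α ^ m * l = ι a * l + ι b ∧
      ι δ ^ n * (l - 1) + 1 = ι a * l + ι b}.Finite := by
  obtain ⟨t, ht0, ht1⟩ : ∃ t : A, t ≠ 0 ∧ (t = a + 1 ∨ t = b - 1) := by
    by_cases h : a = -1
    · exact ⟨b - 1, fun h' => hex ⟨h, by linear_combination h'⟩, Or.inr rfl⟩
    · exact ⟨a + 1, fun h' => h (by linear_combination h'), Or.inl rfl⟩
  obtain ⟨K, iK, iN, φ, ht, hφα, hφδ⟩ := spec_nf α δ (α * δ * b * (a + b - 1) * t)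
    (mul_ne_zero (mul_ne_zero (mul_ne_zero (mul_ne_zero hα hδ) hb) (sub_ne_zero.mpr hab)) ht0) hα1 hδ1
  simp only [map_mul, mul_ne_zero_iff, map_sub, map_add, map_one] at ht
  obtain ⟨⟨⟨⟨a0, d0⟩, b0⟩, ab0⟩, t0⟩ := ht
  have hfin := caseL (φ α) (φ δ) a0 d0 (φ a) (φ b) b0 (sub_ne_zero.mp ab0) (by
    rintro ⟨h1, h2⟩
    apply t0
    rcases ht1 with h | h <;> simp [h, h1, h2])
  have hMfin : {m : ℕ | ∃ (l : ℂ) (n : ℕ), 1 ≤ m ∧ 1 ≤ n ∧ ι α ^ m * l = ι a * l + ι b ∧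
      ι δ ^ n * (l - 1) + 1 = ι a * l + ι b}.Finite := by
    refine (((hfin.inter_of_left {l | l ≠ 0}).biUnion (t := fun l => {m : ℕ | φ α ^ m * l = φ a * l + φ b})
      fun l hl => pow_mul_eq_finite _ _ _ a0 hφα hl.2).union
      (pow_mul_eq_finite (φ α) 1 (φ a) a0 hφα one_ne_zero)).subset ?_
    rintro m ⟨l, n, hm, hn, e1, e2⟩
    by_cases hua : φ α ^ m * 1 = φ a
    · right; exact hua
    left
    rw [mul_one] at hua
    have hua' : φ α ^ m - φ a ≠ 0 := sub_ne_zero.mpr hua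
    have e3 : (δ ^ n - a) * b = (b + δ ^ n - 1) * (α ^ m - a) := by
      apply hι
      simp only [map_mul, map_sub, map_add, map_pow, map_one]
      have : (ι α ^ m - ι a) * l = ι b := by linear_combination e1
      have h2 : (ι δ ^ n - ι a) * l = ι b + ι δ ^ n - 1 := by linear_combination e2
      rw [← h2]
      linear_combination (ι δ ^ n - ι a) * (-this)
    have e4 := congrArg φ e3
    simp only [map_mul, map_sub, map_add, map_pow, map_one] at e4
    set l' := φ b / (φ α ^ m - φ a) with hl'
    have e5 : (φ α ^ m - φ a) * l' = φ b := by rw [hl']; field_simp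
    have e6 : φ α ^ m * l' = φ a * l' + φ b := by linear_combination e5
    rw [Set.mem_iUnion₂]
    refine ⟨l', ⟨⟨m, n, e6, ?_⟩, div_ne_zero b0 hua'⟩, e6⟩
    refine mul_left_cancel₀ hua' ?_
    linear_combination (φ δ ^ n - φ a) * e5 + e4
  refine (hMfin.biUnion (t := fun m => {l : ℂ | (C (ι a - ι α ^ m) * X + C (ι b)).IsRoot l})
    fun m _ => finite_setOfPred_isRoot ?_).subset ?_
  · intro h
    have := congrArg (fun p => p.coeff 0) h
    simp at this
    exact hb (hι (by rw [this, map_zero]))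
  · rintro l ⟨m, n, hm, hn, e1, e2⟩
    rw [Set.mem_iUnion₂]
    refine ⟨m, ⟨l, n, hm, hn, e1, e2⟩, ?_⟩
    simp
    linear_combination -e1
end J

/-- main theorem over the complex numbers, in normal form -/
theorem complex_normal (α δ : ℂ) (hα : α ≠ 0) (hδ : δ ≠ 0)
    (hα1 : ∀ k : ℕ, 1 ≤ k → α ^ k ≠ 1) (hδ1 : ∀ k : ℕ, 1 ≤ k → δ ^ k ≠ 1)
    (c : ℂ[X]) (hc : 2 ≤ c.natDegree ∨ ∃ a b : ℂ, c = C a * X + C b ∧ b ≠ 0 ∧ a + b ≠ 1 ∧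
      ¬ (a = -1 ∧ b = 1)) :
    {l : ℂ | ∃ m n : ℕ, 1 ≤ m ∧ 1 ≤ n ∧ α ^ m * l = c.eval l ∧
      δ ^ n * (l - 1) + 1 = c.eval l}.Finite := by
  classical
  rcases hc with hd | ⟨a, b, rfl, hb, hab, hex⟩
  · let s : Finset ℂ := {α, δ} ∪ c.coeffs
    let A := Algebra.adjoin ℚ (s : Set ℂ)
    have : Algebra.FiniteType ℚ A := (Subalgebra.fg_iff_finiteType _).mp (Subalgebra.fg_adjoin_finset s)
    have hs : ∀ x ∈ s, x ∈ A := fun x hx => Algebra.subset_adjoin hx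
    have hι : Function.Injective (algebraMap A ℂ) := Subtype.val_injective
    obtain ⟨cA, hcA⟩ : c ∈ Set.range (map (algebraMap A ℂ)) := by
      rw [← lifts_iff_set_range, lifts_iff_coeffs_subset_range]
      intro x hx
      exact ⟨⟨x, hs x (Finset.mem_union_right _ hx)⟩, rfl⟩
    rw [← hcA, natDegree_map_eq_of_injective hι] at hd
    let α' : A := ⟨α, hs α (by simp [s])⟩
    let δ' : A := ⟨δ, hs δ (by simp [s])⟩
    rw [← hcA]
    exact transfer_deg (algebraMap A ℂ) hι α' δ' (fun h => hα (congrArg Subtype.val h))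
      (fun h => hδ (congrArg Subtype.val h)) (fun k hk h => hα1 k hk (congrArg Subtype.val h))
      (fun k hk h => hδ1 k hk (congrArg Subtype.val h)) cA hd
  · let s : Finset ℂ := {α, δ, a, b}
    let A := Algebra.adjoin ℚ (s : Set ℂ)
    have : Algebra.FiniteType ℚ A := (Subalgebra.fg_iff_finiteType _).mp (Subalgebra.fg_adjoin_finset s)
    have hs : ∀ x ∈ s, x ∈ A := fun x hx => Algebra.subset_adjoin hx
    have hι : Function.Injective (algebraMap A ℂ) := Subtype.val_injective
    let α' : A := ⟨α, hs α (by simp [s])⟩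
    let δ' : A := ⟨δ, hs δ (by simp [s])⟩
    let a' : A := ⟨a, hs a (by simp [s])⟩
    let b' : A := ⟨b, hs b (by simp [s])⟩
    have := transfer_lin (algebraMap A ℂ) hι α' δ' (fun h => hα (congrArg Subtype.val h))
      (fun h => hδ (congrArg Subtype.val h)) (fun k hk h => hα1 k hk (congrArg Subtype.val h))
      (fun k hk h => hδ1 k hk (congrArg Subtype.val h)) a' b' (fun h => hb (congrArg Subtype.val h))
      (fun h => hab (congrArg Subtype.val h))
      (fun h => hex ⟨congrArg Subtype.val h.1, congrArg Subtype.val h.2⟩)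
    simpa using this

end PartJ

section PartL
open Polynomial

section L

lemma lifts_of_infinite {F E : Type*} [Field F] [Field E] (ψ : F →+* E) (c : E[X])
    (h : {x : F | ∃ y : F, c.eval (ψ x) = ψ y}.Infinite) : ∃ C' : F[X], C'.map ψ = c := by
  classical
  obtain ⟨s, hs, hcard⟩ := h.exists_subset_card_eq (c.natDegree + 1)
  have hs' : ∀ x : F, ∃ y : F, x ∈ s → c.eval (ψ x) = ψ y := by
    intro x
    by_cases hx : x ∈ s
    · obtain ⟨y, hy⟩ := hs hx; exact ⟨y, fun _ => hy⟩
    · exact ⟨0, fun h => absurd h hx⟩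
  choose r hr using hs'
  refine ⟨Lagrange.interpolate s id r, ?_⟩
  refine eq_of_degrees_lt_of_eval_index_eq (s := s) (v := ψ) (ψ.injective.injOn) ?_ ?_ ?_
  · rw [degree_map]; exact Lagrange.degree_interpolate_lt r Function.injective_id.injOn
  · rw [hcard]; exact lt_of_le_of_lt degree_le_natDegree (by exact_mod_cast Nat.lt_succ_self _)
  · intro i hi
    rw [eval_map_apply, hr i hi]
    congr 1
    exact Lagrange.eval_interpolate_at_node (v := id) r Function.injective_id.injOn hi

lemma zeta_finite (p : ℚ[X]) (hp : p ≠ 0) :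
    {m : ℕ | 1 ≤ m ∧ aeval (Complex.exp (2 * Real.pi * Complex.I / m)) p = 0}.Finite := by
  have hfin := (p.map (algebraMap ℚ ℂ)).finite_setOfPred_isRoot
    ((Polynomial.map_ne_zero_iff (algebraMap ℚ ℂ).injective).mpr hp)
  refine Set.Finite.of_injOn (f := fun m : ℕ => Complex.exp (2 * Real.pi * Complex.I / m)) ?_ ?_ hfin
  · rintro m ⟨hm, h⟩
    simpa [IsRoot, eval_map_algebraMap] using h
  · rintro a ⟨ha, -⟩ b ⟨hb, -⟩ hab
    have h1 := (Complex.isPrimitiveRoot_exp a (by omega)).eq_orderOf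
    have h2 := (Complex.isPrimitiveRoot_exp b (by omega)).eq_orderOf
    simp only at hab
    rw [h1, h2, hab]

theorem trans_case (α : ℂ) (hα : Transcendental ℚ α) (c : ℂ[X])
    (hcf : ∀ m : ℕ, 1 ≤ m → ¬ ∀ x, c.eval x = α ^ m * x)
    (hcg : ∀ n : ℕ, 1 ≤ n → ¬ ∀ x, c.eval x = x + n) :
    {l : ℂ | ∃ m n : ℕ, 1 ≤ m ∧ 1 ≤ n ∧ α ^ m * l = l + n ∧ l + n = c.eval l}.Finite := by
  by_contra hinf
  let φ : ℚ[X] →+* ℂ := (aeval α : ℚ[X] →ₐ[ℚ] ℂ).toRingHom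
  have hφ : Function.Injective φ := transcendental_iff_injective.mp hα
  have hφX : φ X = α := aeval_X α
  let ψ : FractionRing ℚ[X] →+* ℂ := IsFractionRing.lift hφ
  have hψ : ∀ p : ℚ[X], ψ (algebraMap _ _ p) = φ p := fun p => IsFractionRing.lift_algebraMap hφ p
  have hα1 : ∀ m : ℕ, 1 ≤ m → α ^ m - 1 ≠ 0 := by
    intro m hm h
    have : (X ^ m - C 1 : ℚ[X]) = 0 := hφ (by simp [hφX, h])
    exact X_pow_sub_C_ne_zero hm 1 this
  -- the coefficients are rational functions in `α`
  obtain ⟨C', hC'⟩ := lifts_of_infinite ψ c (by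
    intro hfin
    apply hinf
    refine (hfin.image ψ).subset ?_
    rintro l ⟨m, n, hm, hn, e1, e2⟩
    have hl : ψ (algebraMap _ _ (n : ℚ[X]) / algebraMap _ _ (X ^ m - 1 : ℚ[X])) = l := by
      rw [map_div₀, hψ, hψ, map_sub, map_pow, hφX, map_one, map_natCast, div_eq_iff (hα1 m hm)]
      linear_combination -e1
    refine ⟨_, ⟨algebraMap _ _ (n : ℚ[X]) / algebraMap _ _ (X ^ m - 1 : ℚ[X]) + n, ?_⟩, hl⟩
    rw [map_add, hl, map_natCast, e2])
  obtain ⟨D, hD, hDC⟩ := IsLocalization.integerNormalization_spec (nonZeroDivisors ℚ[X]) C'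
  have D0 : D ≠ 0 := nonZeroDivisors.ne_zero hD
  set C₁ := IsLocalization.integerNormalization (nonZeroDivisors ℚ[X]) C' with hC₁
  have hC₁c : C₁.map φ = C (φ D) * c := by
    have h := congrArg (map ψ) hDC
    rw [map_map, show ψ.comp (algebraMap ℚ[X] (FractionRing ℚ[X])) = φ from RingHom.ext hψ] at h
    rw [h, ← hC', algebra_compatible_smul (FractionRing ℚ[X]) D C', smul_eq_C_mul,
      Polynomial.map_mul, map_C, hψ]
  have fD0 : φ D ≠ 0 := fun h => D0 (hφ (by rw [h, map_zero]))
  -- finitely many points for every `m`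
  have hMinf : {m : ℕ | ∃ (l : ℂ) (n : ℕ), 1 ≤ m ∧ 1 ≤ n ∧ α ^ m * l = l + n ∧ l + n = c.eval l}.Infinite := by
    intro hM
    apply hinf
    refine (hM.biUnion (t := fun m => {l : ℂ | (c - C (α ^ m) * X).IsRoot l})
      fun m hm => finite_setOfPred_isRoot ?_).subset ?_
    · obtain ⟨_, _, hm, -⟩ := hm
      intro h
      apply hcf m hm
      intro x
      rw [sub_eq_zero.mp h]; simp
    · rintro l ⟨m, n, hm, hn, e1, e2⟩
      rw [Set.mem_iUnion₂]
      refine ⟨m, ⟨l, n, hm, hn, e1, e2⟩, ?_⟩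
      simp [← e2, e1]
  have hz : ∀ m : ℕ, 1 ≤ m → Complex.exp (2 * Real.pi * Complex.I / m) ^ m = 1 := fun m hm =>
    (Complex.isPrimitiveRoot_exp m (by omega)).pow_eq_one
  have hdeg : C₁.natDegree = c.natDegree := by
    rw [← natDegree_map_eq_of_injective hφ, hC₁c, natDegree_C_mul fD0]
  by_cases hd : 2 ≤ c.natDegree
  · have c0 : C₁ ≠ 0 := by intro h; rw [h] at hdeg; simp at hdeg; omega
    apply hMinf
    refine (zeta_finite C₁.leadingCoeff (leadingCoeff_ne_zero.mpr c0)).subset ?_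
    rintro m ⟨l, n, hm, hn, e1, e2⟩
    refine ⟨hm, ?_⟩
    by_contra hne
    have e3 : φ (X ^ m - 1) * l = φ (n : ℚ[X]) := by
      simp only [map_sub, map_one, map_pow, hφX, map_natCast]; linear_combination e1
    have key : eval (n : ℚ[X]) (C₁.scaleRoots (X ^ m - 1)) =
        (X ^ m - 1) ^ (c.natDegree - 1) * (D * X ^ m * (n : ℚ[X])) := by
      apply hφ
      rw [← eval₂_at_apply, ← e3, scaleRoots_eval₂_mul, ← eval_map, hC₁c, eval_mul, ← e2, ← e1, hdeg]
      simp only [map_mul, map_pow, eval_C]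
      rw [← e3, hφX]
      obtain ⟨j, hj⟩ : ∃ j, c.natDegree = j + 1 := ⟨c.natDegree - 1, by omega⟩
      rw [hj, Nat.add_sub_cancel]; ring
    let ev : ℚ[X] →+* ℂ := (aeval (Complex.exp (2 * Real.pi * Complex.I / m)) : ℚ[X] →ₐ[ℚ] ℂ).toRingHom
    have hev : ev X = Complex.exp (2 * Real.pi * Complex.I / m) := aeval_X _
    have hne' : ev C₁.leadingCoeff ≠ 0 := hne
    have key' := congrArg ev key
    rw [← eval_map_apply, map_scaleRoots _ _ _ hne'] at key'
    simp only [map_mul, map_pow, map_sub, map_one, hev, hz m hm, sub_self, map_natCast] at key'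
    rw [scaleRoots_zero, zero_pow (by omega), zero_mul,
      leadingCoeff_map_of_leadingCoeff_ne_zero _ hne'] at key'
    simp only [eval_smul, eval_pow, eval_X, smul_eq_mul] at key'
    exact mul_ne_zero hne' (pow_ne_zero _ (by exact_mod_cast (by omega : n ≠ 0))) key'
  · obtain ⟨a, b, hab⟩ : ∃ a b : ℂ, c = C a * X + C b :=
      exists_eq_X_add_C_of_natDegree_le_one (by omega)
    have hA : φ (C₁.coeff 1) = φ D * a := by
      rw [← coeff_map, hC₁c, hab]; simp
    have hB : φ (C₁.coeff 0) = φ D * b := by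
      rw [← coeff_map, hC₁c, hab]; simp
    have hAD : C₁.coeff 1 - D = 0 := by
      by_contra h0
      apply hMinf
      refine (zeta_finite _ h0).subset ?_
      rintro m ⟨l, n, hm, hn, e1, e2⟩
      refine ⟨hm, ?_⟩
      have key : C₁.coeff 1 * (n : ℚ[X]) + C₁.coeff 0 * (X ^ m - 1) = D * X ^ m * (n : ℚ[X]) := by
        apply hφ
        simp only [map_mul, map_add, map_sub, map_one, map_pow, hφX, map_natCast, hA, hB]
        rw [hab] at e2
        simp only [eval_add, eval_mul, eval_C, eval_X] at e2
        linear_combination (φ D * (a - 1)) * (-e1) + φ D * (α ^ m - 1) * (-e2) 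
      have key' := congrArg (aeval (Complex.exp (2 * Real.pi * Complex.I / m))) key
      simp only [map_mul, map_add, map_sub, map_one, map_pow, aeval_X, map_natCast, hz m hm] at key'
      have hn0 : (n : ℂ) ≠ 0 := by exact_mod_cast (by omega : n ≠ 0)
      rw [map_sub]
      refine mul_right_cancel₀ hn0 ?_
      linear_combination key'
    have a1 : a = 1 := by
      rw [sub_eq_zero.mp hAD] at hA
      exact mul_left_cancel₀ fD0 (by rw [← hA, mul_one])
    obtain ⟨m, l, n, hm, hn, e1, e2⟩ := hMinf.nonempty
    apply hcg n hn
    intro x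
    rw [hab] at e2 ⊢
    simp only [eval_add, eval_mul, eval_C, eval_X, a1] at e2 ⊢
    linear_combination -e2

end L

end PartL

section PartM
open Polynomial

section M

/-- composite along a word -/
def wd (f g : ℂ → ℂ) (w : List Bool) : ℂ → ℂ :=
  (w.map fun b => if b then f else g).foldr (· ∘ ·) id

lemma wd_nil (f g : ℂ → ℂ) : wd f g [] = id := rfl

lemma wd_cons (f g : ℂ → ℂ) (b : Bool) (w : List Bool) :
    wd f g (b :: w) = (if b then f else g) ∘ wd f g w := rfl

lemma wd_append (f g : ℂ → ℂ) (w₁ w₂ : List Bool) :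
    wd f g (w₁ ++ w₂) = wd f g w₁ ∘ wd f g w₂ := by
  induction w₁ with
  | nil => rfl
  | cons b w ih => rw [List.cons_append, wd_cons, wd_cons, ih]; rfl

lemma wd_true (f g : ℂ → ℂ) (k : ℕ) : wd f g (List.replicate k true) = f^[k] := by
  induction k with
  | zero => rfl
  | succ k ih => rw [List.replicate_succ, wd_cons, ih, Function.iterate_succ']; rfl

lemma wd_false (f g : ℂ → ℂ) (k : ℕ) : wd f g (List.replicate k false) = g^[k] := by
  induction k with
  | zero => rfl
  | succ k ih => rw [List.replicate_succ, wd_cons, ih, Function.iterate_succ']; rfl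

lemma wd_swap (f g : ℂ → ℂ) (w : List Bool) : wd g f w = wd f g (w.map not) := by
  induction w with
  | nil => rfl
  | cons b w ih => rw [List.map_cons, wd_cons, wd_cons, ih]; cases b <;> rfl

def IsFreePair (f g : ℂ → ℂ) : Prop :=
  ∀ w₁ w₂ : List Bool, w₁ ≠ [] → w₂ ≠ [] → wd f g w₁ = wd f g w₂ → w₁ = w₂

lemma IsFreePair.swap {f g : ℂ → ℂ} (h : IsFreePair f g) : IsFreePair g f := by
  intro w₁ w₂ h1 h2 he
  rw [wd_swap, wd_swap f g w₂] at he
  have := h _ _ (by simpa using h1) (by simpa using h2) he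
  exact List.map_injective_iff.mpr (fun a b => by cases a <;> cases b <;> simp) this

lemma IsFreePair.not_comm {f g : ℂ → ℂ} (h : IsFreePair f g) : ¬ ∀ x, f (g x) = g (f x) := by
  intro hc
  have := h [true, false] [false, true] (by simp) (by simp) (by
    funext x; simp [wd, hc])
  simp at this

lemma IsFreePair.iter_ne {f g : ℂ → ℂ} (h : IsFreePair f g) (k : ℕ) (hk : 1 ≤ k) :
    ¬ ∀ x, f^[k] x = x := by
  intro hc
  have := h (List.replicate (k + 1) true) (List.replicate 1 true) (by simp) (by simp) (by
    rw [wd_true, wd_true]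
    funext x
    rw [Function.iterate_succ_apply, hc]; rfl)
  have := congrArg List.length this
  simp at this
  omega

lemma IsFreePair.no_trans {f g : ℂ → ℂ} (h : IsFreePair f g) (m n : ℕ) (hm : 1 ≤ m) (hn : 1 ≤ n)
    (s t : ℂ) (h1 : ∀ x, f^[m] (g^[n] x) = x + s) (h2 : ∀ x, g^[n] (f^[m] x) = x + t) : False := by
  have := h (List.replicate m true ++ (List.replicate n false ++ (List.replicate n false ++ List.replicate m true)))
    (List.replicate n false ++ (List.replicate m true ++ (List.replicate m true ++ List.replicate n false)))
    (by simp; omega) (by simp; omega) (by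
    simp only [wd_append, wd_true, wd_false]
    funext x
    simp only [Function.comp_apply]
    rw [h1, h2, h1, h2]; ring)
  obtain ⟨m', rfl⟩ : ∃ j, m = j + 1 := ⟨m - 1, by omega⟩
  obtain ⟨n', rfl⟩ : ∃ j, n = j + 1 := ⟨n - 1, by omega⟩
  simp [List.replicate_succ] at this

/-- word attached to a list of exponents -/
def expWord : List ℕ → List Bool
  | [] => []
  | k :: t => List.replicate k false ++ true :: expWord t

lemma replicate_inj : ∀ (a b : ℕ) (u v : List Bool),
    List.replicate a false ++ true :: u = List.replicate b false ++ true :: v → a = b ∧ u = v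
  | 0, 0, u, v, h => by simpa using h
  | a + 1, 0, u, v, h => by simp [List.replicate_succ] at h
  | 0, b + 1, u, v, h => by simp [List.replicate_succ] at h
  | a + 1, b + 1, u, v, h => by
    simp only [List.replicate_succ, List.cons_append, List.cons.injEq, true_and] at h
    have := replicate_inj a b u v h
    exact ⟨by omega, this.2⟩

lemma expWord_inj : ∀ u v : List ℕ, expWord u = expWord v → u = v
  | [], [], _ => rfl
  | [], k :: t, h => by simp [expWord] at h
  | k :: t, [], h => by simp [expWord] at h
  | k :: t, k' :: t', h => by
    obtain ⟨h1, h2⟩ := replicate_inj _ _ _ _ h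
    rw [h1, expWord_inj t t' h2]

/-- Horner evaluation -/
def horner (α : ℂ) : List ℕ → ℂ
  | [] => 0
  | k :: t => k + α * horner α t

lemma horner_range (α : ℂ) : ∀ (N : ℕ) (n : ℕ → ℕ),
    horner α ((List.range N).map n) = ∑ i ∈ Finset.range N, (n i : ℂ) * α ^ i
  | 0, n => by simp [horner]
  | N + 1, n => by
    rw [List.range_succ_eq_map, List.map_cons, List.map_map, horner, Finset.sum_range_succ',
      horner_range α N (n ∘ Nat.succ), Finset.mul_sum]
    simp only [Function.comp_apply, Nat.succ_eq_add_one, pow_zero, mul_one]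
    rw [add_comm]
    congr 1
    exact Finset.sum_congr rfl fun i _ => by ring

lemma trans_iter (g : ℂ → ℂ) (γ : ℂ) (hg : ∀ x, g x = x + γ) (n : ℕ) (x : ℂ) :
    g^[n] x = x + n * γ := by
  induction n generalizing x with
  | zero => simp
  | succ n ih => rw [Function.iterate_succ_apply, ih, hg]; push_cast; ring

lemma aff_iter (f : ℂ → ℂ) (α p : ℂ) (hf : ∀ x, f x = α * (x - p) + p) (n : ℕ) (x : ℂ) :
    f^[n] x = α ^ n * (x - p) + p := by
  induction n generalizing x with
  | zero => simp
  | succ n ih => rw [Function.iterate_succ_apply, ih, hf]; ring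

lemma expWord_apply (f g : ℂ → ℂ) (α β γ : ℂ) (hf : ∀ x, f x = α * x + β) (hg : ∀ x, g x = x + γ)
    (x : ℂ) : ∀ u v : List ℕ, u.length = v.length →
    wd f g (expWord u) x - wd f g (expWord v) x = γ * (horner α u - horner α v)
  | [], [], _ => by simp
  | [], k :: t, h => by simp at h
  | k :: t, [], h => by simp at h
  | k :: t, k' :: t', h => by
    have ih := expWord_apply f g α β γ hf hg x t t' (by simpa using h)
    simp only [expWord, wd_append, wd_cons, wd_false, Function.comp_apply, horner]
    simp only [if_true, trans_iter g γ hg, hf]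
    linear_combination α * ih

lemma IsFreePair.transcendental {f g : ℂ → ℂ} (h : IsFreePair f g) (α β γ : ℂ)
    (hf : ∀ x, f x = α * x + β) (hg : ∀ x, g x = x + γ) : Transcendental ℚ α := by
  intro halg
  rw [← IsFractionRing.isAlgebraic_iff ℤ ℚ ℂ] at halg
  obtain ⟨P, P0, hP⟩ := halg
  set N := P.natDegree + 1 with hN
  let n1 : ℕ → ℕ := fun i => (P.coeff i).toNat
  let n2 : ℕ → ℕ := fun i => (-P.coeff i).toNat
  have hdiff : ∀ i, ((n1 i : ℤ) - n2 i) = P.coeff i := by intro i; simp only [n1, n2]; omega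
  have hsum : horner α ((List.range N).map n1) - horner α ((List.range N).map n2) = 0 := by
    rw [horner_range, horner_range, ← Finset.sum_sub_distrib, ← hP, aeval_eq_sum_range]
    refine Finset.sum_congr rfl fun i _ => ?_
    rw [← hdiff i]
    simp; ring
  have hw : expWord ((List.range N).map n1) = expWord ((List.range N).map n2) := by
    apply h
    · rw [hN, List.range_succ_eq_map]; simp [expWord]
    · rw [hN, List.range_succ_eq_map]; simp [expWord]
    · funext x
      have := expWord_apply f g α β γ hf hg x ((List.range N).map n1) ((List.range N).map n2) (by simp)
      rw [hsum, mul_zero] at this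
      exact sub_eq_zero.mp this
  have h3 := expWord_inj _ _ hw
  rw [List.map_inj_left] at h3
  apply P0
  rw [← leadingCoeff_eq_zero, leadingCoeff, ← hdiff, h3 P.natDegree (by simp [hN])]
  simp

lemma conj_eval (c : ℂ[X]) (s p y : ℂ) (hs : s ≠ 0) :
    p + s * (C s⁻¹ * (c.comp (C s * X + C p) - C p)).eval y = c.eval (p + s * y) := by
  simp only [eval_mul, eval_C, eval_sub, eval_comp, eval_add, eval_X]
  rw [← mul_assoc, mul_inv_cancel₀ hs, add_comm (s * y) p]; ring

/-- one of the maps is a translation -/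
theorem final_trans (f g : ℂ → ℂ) (α β γ : ℂ) (hα1 : α ≠ 1)
    (hf : ∀ x, f x = α * x + β) (hg : ∀ x, g x = x + γ) (hfree : IsFreePair f g) (c : ℂ[X])
    (hcf : ∀ m : ℕ, 1 ≤ m → ¬ ∀ x, c.eval x = f^[m] x)
    (hcg : ∀ n : ℕ, 1 ≤ n → ¬ ∀ x, c.eval x = g^[n] x) :
    {l : ℂ | ∃ m n : ℕ, 1 ≤ m ∧ 1 ≤ n ∧ f^[m] l = g^[n] l ∧ g^[n] l = c.eval l}.Finite := by
  have htr := hfree.transcendental α β γ hf hg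
  have hα1' : 1 - α ≠ 0 := sub_ne_zero.mpr hα1.symm
  obtain ⟨p, hp⟩ : ∃ p, α * p + β = p := ⟨β / (1 - α), by field_simp; ring⟩
  have hf' : ∀ x, f x = α * (x - p) + p := fun x => by rw [hf]; linear_combination hp
  have γ0 : γ ≠ 0 := by
    rintro rfl
    exact hfree.swap.iter_ne 1 le_rfl (fun x => by simp [hg])
  have fi := aff_iter f α p hf'
  have gi := trans_iter g γ hg
  set c' := C γ⁻¹ * (c.comp (C γ * X + C p) - C p) with hc'
  have hce : ∀ y, p + γ * c'.eval y = c.eval (p + γ * y) := fun y => conj_eval c γ p y γ0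
  have hx : ∀ x, p + γ * ((x - p) / γ) = x := fun x => by field_simp; ring
  have := trans_case α htr c' (fun m hm h => hcf m hm fun x => by
      rw [fi, ← hx x, ← hce, h]; ring) (fun n hn h => hcg n hn fun x => by
      rw [gi, ← hx x, ← hce, h]; ring)
  refine (this.image fun y => p + γ * y).subset ?_
  rintro l ⟨m, n, hm, hn, e1, e2⟩
  refine ⟨(l - p) / γ, ⟨m, n, hm, hn, ?_, ?_⟩, hx l⟩
  · rw [fi, gi] at e1
    field_simp; linear_combination e1
  · rw [gi] at e2
    have := hce ((l - p) / γ)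
    rw [hx l] at this
    refine mul_left_cancel₀ γ0 ?_
    have h3 : γ * ((l - p) / γ) = l - p := by field_simp
    linear_combination e2 - this + h3

/-- fixed points 0 and 1 -/
theorem normal_all (α δ : ℂ) (hα : α ≠ 0) (hδ : δ ≠ 0)
    (hα1 : ∀ k : ℕ, 1 ≤ k → α ^ k ≠ 1) (hδ1 : ∀ k : ℕ, 1 ≤ k → δ ^ k ≠ 1)
    (hprod : ∀ m n : ℕ, 1 ≤ m → 1 ≤ n → α ^ m * δ ^ n ≠ 1)
    (c : ℂ[X]) (hcf : ∀ m : ℕ, 1 ≤ m → ¬ ∀ x, c.eval x = α ^ m * x)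
    (hcg : ∀ n : ℕ, 1 ≤ n → ¬ ∀ x, c.eval x = δ ^ n * (x - 1) + 1) :
    {l : ℂ | ∃ m n : ℕ, 1 ≤ m ∧ 1 ≤ n ∧ α ^ m * l = c.eval l ∧
      δ ^ n * (l - 1) + 1 = c.eval l}.Finite := by
  by_cases hd : 2 ≤ c.natDegree
  · exact complex_normal α δ hα hδ hα1 hδ1 c (Or.inl hd)
  obtain ⟨a, b, hab⟩ : ∃ a b : ℂ, c = C a * X + C b :=
      exists_eq_X_add_C_of_natDegree_le_one (by omega)
  have hev : ∀ x, c.eval x = a * x + b := fun x => by rw [hab]; simp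
  by_cases hgood : b ≠ 0 ∧ a + b ≠ 1 ∧ ¬ (a = -1 ∧ b = 1)
  · exact complex_normal α δ hα hδ hα1 hδ1 c (Or.inr ⟨a, b, hab, hgood⟩)
  refine (Set.toFinite {(0 : ℂ), 1}).subset ?_
  rintro l ⟨m, n, hm, hn, e1, e2⟩
  rw [hev] at e1 e2
  by_contra hl
  simp only [Set.mem_insert_iff, Set.mem_singleton_iff, not_or] at hl
  obtain ⟨l0, l1⟩ := hl
  have l1' : l - 1 ≠ 0 := sub_ne_zero.mpr l1
  apply hgood
  refine ⟨?_, ?_, ?_⟩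
  · rintro rfl
    apply hcf m hm
    intro x
    have : α ^ m = a := mul_right_cancel₀ l0 (by linear_combination e1)
    rw [hev, this]; ring
  · intro h
    apply hcg n hn
    intro x
    have : δ ^ n = a := mul_right_cancel₀ l1' (by linear_combination e2 + h)
    rw [hev, this]; linear_combination h
  · rintro ⟨rfl, rfl⟩
    apply hprod m n hm hn
    refine mul_right_cancel₀ l1' ?_
    linear_combination α ^ m * e2 - e1

theorem final_two (f g : ℂ → ℂ) (α δ β γ : ℂ) (hα : α ≠ 0) (hδ : δ ≠ 0) (hα1 : α ≠ 1) (hδ1 : δ ≠ 1)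
    (hf : ∀ x, f x = α * x + β) (hg : ∀ x, g x = δ * x + γ) (hfree : IsFreePair f g) (c : ℂ[X])
    (hcf : ∀ m : ℕ, 1 ≤ m → ¬ ∀ x, c.eval x = f^[m] x)
    (hcg : ∀ n : ℕ, 1 ≤ n → ¬ ∀ x, c.eval x = g^[n] x) :
    {l : ℂ | ∃ m n : ℕ, 1 ≤ m ∧ 1 ≤ n ∧ f^[m] l = g^[n] l ∧ g^[n] l = c.eval l}.Finite := by
  have hα1' : 1 - α ≠ 0 := sub_ne_zero.mpr hα1.symm
  have hδ1' : 1 - δ ≠ 0 := sub_ne_zero.mpr hδ1.symm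
  obtain ⟨p, hp⟩ : ∃ p, α * p + β = p := ⟨β / (1 - α), by field_simp; ring⟩
  obtain ⟨q, hq⟩ : ∃ q, δ * q + γ = q := ⟨γ / (1 - δ), by field_simp; ring⟩
  have hf' : ∀ x, f x = α * (x - p) + p := fun x => by rw [hf]; linear_combination hp
  have hg' : ∀ x, g x = δ * (x - q) + q := fun x => by rw [hg]; linear_combination hq
  have fi := aff_iter f α p hf'
  have gi := aff_iter g δ q hg'
  have hpq : q - p ≠ 0 := by
    intro h
    have : q = p := sub_eq_zero.mp h
    subst this
    exact hfree.not_comm fun x => by rw [hf', hg', hg', hf']; ring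
  set s := q - p with hs
  have hqs : q = p + s := by rw [hs]; ring
  set c' := C s⁻¹ * (c.comp (C s * X + C p) - C p) with hc'
  have hce : ∀ y, p + s * c'.eval y = c.eval (p + s * y) := fun y => conj_eval c s p y hpq
  have hx : ∀ x, p + s * ((x - p) / s) = x := fun x => by field_simp; ring
  have := normal_all α δ hα hδ
    (fun k hk h => hfree.iter_ne k hk fun x => by rw [fi, h]; ring)
    (fun k hk h => hfree.swap.iter_ne k hk fun x => by rw [gi, h]; ring)
    (fun m n hm hn h => hfree.no_trans m n hm hn (-q + α ^ m * (q - p) + p) (-p + δ ^ n * (p - q) + q)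
      (fun x => by rw [fi, gi]; linear_combination (x - q) * h)
      (fun x => by rw [fi, gi]; linear_combination (x - p) * h))
    c' (fun m hm h => hcf m hm fun x => by
      rw [fi, ← hx x, ← hce, h]; ring) (fun n hn h => hcg n hn fun x => by
      rw [gi, ← hx x, ← hce, h, hqs]; ring)
  refine (this.image fun y => p + s * y).subset ?_
  rintro l ⟨m, n, hm, hn, e1, e2⟩
  have h3 : s * ((l - p) / s) = l - p := by field_simp
  have h4 := hce ((l - p) / s)
  rw [hx l] at h4
  refine ⟨(l - p) / s, ⟨m, n, hm, hn, ?_, ?_⟩, hx l⟩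
  · rw [e2, fi] at e1
    refine mul_left_cancel₀ hpq ?_
    linear_combination e1 - h4 + α ^ m * h3
  · rw [gi, hqs] at e2
    refine mul_left_cancel₀ hpq ?_
    linear_combination e2 - h4 + δ ^ n * h3

lemma iter_comp_eval (F : ℂ[X]) (f : ℂ → ℂ) (hf : ∀ x, F.eval x = f x) (m : ℕ) (x : ℂ) :
    ((fun q : ℂ[X] => q.comp F)^[m] X).eval x = f^[m] x := by
  induction m generalizing x with
  | zero => simp
  | succ m ih => rw [Function.iterate_succ_apply', eval_comp, ih, hf, Function.iterate_succ_apply]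

end M


end PartM

theorem stmt10 (α δ β γ : ℂ) (hα : α ≠ 0) (hδ : δ ≠ 0)
    (f g : ℂ → ℂ)
    (hf : ∀ x, f x = α * x + β) (hg : ∀ x, g x = δ * x + γ)
    (c : Polynomial ℂ)
    (hcf : ∀ m : ℕ, 1 ≤ m →
      c ≠ (fun q : Polynomial ℂ =>
        q.comp (Polynomial.C α * Polynomial.X + Polynomial.C β))^[m] Polynomial.X)
    (hcg : ∀ n : ℕ, 1 ≤ n →
      c ≠ (fun q : Polynomial ℂ =>
        q.comp (Polynomial.C δ * Polynomial.X + Polynomial.C γ))^[n] Polynomial.X)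
    (hfree : ∀ w₁ w₂ : List Bool, w₁ ≠ [] → w₂ ≠ [] → w₁ ≠ w₂ →
      (w₁.map fun b => if b then f else g).foldr (· ∘ ·) id ≠
      (w₂.map fun b => if b then f else g).foldr (· ∘ ·) id) :
    {l : ℂ | ∃ m n : ℕ, 1 ≤ m ∧ 1 ≤ n ∧
      f^[m] l = g^[n] l ∧ g^[n] l = c.eval l}.Finite := by
  have hfr : IsFreePair f g := by
    intro w₁ w₂ h1 h2 h
    by_contra hne
    exact hfree w₁ w₂ h1 h2 hne h
  have hcf' : ∀ m : ℕ, 1 ≤ m → ¬ ∀ x, c.eval x = f^[m] x := fun m hm h => hcf m hm <|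
    Polynomial.funext fun x => by rw [h, iter_comp_eval _ f (fun x => by simp [hf])]
  have hcg' : ∀ n : ℕ, 1 ≤ n → ¬ ∀ x, c.eval x = g^[n] x := fun n hn h => hcg n hn <|
    Polynomial.funext fun x => by rw [h, iter_comp_eval _ g (fun x => by simp [hg])]
  by_cases hα1 : α = 1
  · by_cases hδ1 : δ = 1
    · exact absurd (fun x => by rw [hf, hg, hg, hf, hα1, hδ1]; ring) hfr.not_comm
    · refine (final_trans g f δ γ β hδ1 hg (fun x => by rw [hf, hα1, one_mul]) hfr.swap c hcg' hcf').subset ?_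
      rintro l ⟨m, n, hm, hn, e1, e2⟩
      exact ⟨n, m, hn, hm, e1.symm, e1.trans e2⟩
  · by_cases hδ1 : δ = 1
    · exact final_trans f g α β γ hα1 hf (fun x => by rw [hg, hδ1, one_mul]) hfr c hcf' hcg'
    · exact final_two f g α δ β γ hα hδ hα1 hδ1 hf hg hfr c hcf' hcg'
end

section
/- Let K be a number field with ring of integers 𝒪_K. Let 𝔨 be an ideal of 𝒪_K and let d₁, d₂, d₃, a, b ∈ 𝒪_K. Then the set { n ∈ ℕ : b·(d₁^n − d₃) − a·(d₂^n − d₃) ∈ 𝔨 · (d₁^n − d₃, d₂^n − d₃) } is a finite union of arithmetic progressions, where (d₁^n − d₃, d₂^n − d₃) denotes the ideal of 𝒪_K generated by d₁^n − d₃ and d₂^n − d₃, and 𝔨 · I denotes the product of the ideals 𝔨 and I. -/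
/-- Eventually periodic predicates on the natural numbers. -/
def EvPer (P : ℕ → Prop) : Prop :=
  ∃ N M : ℕ, 0 < M ∧ ∀ n, N ≤ n → (P (n + M) ↔ P n)

namespace EvPer

lemma iter {P : ℕ → Prop} {N M : ℕ} (h : ∀ n, N ≤ n → (P (n + M) ↔ P n)) :
    ∀ k n, N ≤ n → (P (n + M * k) ↔ P n) := by
  intro k
  induction k with
  | zero => intro n _; simp
  | succ k ih =>
    intro n hn
    rw [← ih n hn, ← h (n + M * k) (by omega)]
    rw [Nat.mul_succ, Nat.add_assoc]

lemma const (p : Prop) : EvPer (fun _ => p) := ⟨0, 1, one_pos, fun _ _ => Iff.rfl⟩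

lemma congr_ev {P Q : ℕ → Prop} (N₀ : ℕ) (h : ∀ n, N₀ ≤ n → (P n ↔ Q n)) (hQ : EvPer Q) :
    EvPer P := by
  obtain ⟨N, M, hM, hN⟩ := hQ
  refine ⟨N + N₀, M, hM, fun n hn => ?_⟩
  rw [h n (by omega), h (n + M) (by omega), hN n (by omega)]

lemma and {P Q : ℕ → Prop} (hP : EvPer P) (hQ : EvPer Q) : EvPer (fun n => P n ∧ Q n) := by
  obtain ⟨N, M, hM, h⟩ := hP
  obtain ⟨N', M', hM', h'⟩ := hQ
  refine ⟨N + N', M * M', by positivity, fun n hn => ?_⟩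
  have h1 := iter h M' n (by omega)
  have h2 := iter h' M n (by omega)
  rw [Nat.mul_comm M' M] at h2
  show (P (n + M * M') ∧ Q (n + M * M')) ↔ _
  rw [h1, h2]

lemma forall_finset {ι : Type*} (s : Finset ι) (P : ι → ℕ → Prop) (h : ∀ i ∈ s, EvPer (P i)) :
    EvPer (fun n => ∀ i ∈ s, P i n) := by
  classical
  induction s using Finset.induction_on with
  | empty => simpa using const True
  | insert a s ha ih =>
    have h1 := (h a (by simp)).and (ih (fun i hi => h i (by simp [hi])))
    refine congr_ev 0 (fun n _ => ?_) h1
    simp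

lemma of_classes {P : ℕ → Prop} (T : ℕ) (hT : 0 < T)
    (h : ∀ r, EvPer (fun m => P (r + T * m))) : EvPer P := by
  choose N M hM h using h
  refine ⟨T * (∑ r ∈ Finset.range T, N r + 1), T * ∏ r ∈ Finset.range T, M r,
    Nat.mul_pos hT (Finset.prod_pos fun r _ => hM r), fun n hn => ?_⟩
  have hr : n % T ∈ Finset.range T := Finset.mem_range.2 (Nat.mod_lt _ hT)
  obtain ⟨c, hc⟩ := Finset.dvd_prod_of_mem M hr
  have hle : N (n % T) ≤ ∑ r ∈ Finset.range T, N r :=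
    Finset.single_le_sum (f := N) (fun _ _ => Nat.zero_le _) hr
  have hnd : ∑ r ∈ Finset.range T, N r + 1 ≤ n / T := by
    rw [Nat.le_div_iff_mul_le hT, Nat.mul_comm]; exact hn
  have := iter (P := fun m => P (n % T + T * m)) (h (n % T)) c (n / T) (le_trans hle (by omega))
  rw [hc]
  have e : n % T + T * (n / T + M (n % T) * c) = n + T * (M (n % T) * c) := by
    rw [Nat.mul_add, ← Nat.add_assoc, Nat.mod_add_div]
  simp only [e, Nat.mod_add_div] at this
  exact this

lemma toAP {P : ℕ → Prop} (h : EvPer P) :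
    ∃ s : Finset (ℕ × ℕ), {n : ℕ | P n} = ⋃ p ∈ s, {n : ℕ | ∃ k : ℕ, n = p.1 + p.2 * k} := by
  classical
  obtain ⟨N, M, hM, h⟩ := h
  refine ⟨((Finset.range N).filter P).image (fun n => (n, 0)) ∪
    ((Finset.Ico N (N + M)).filter P).image (fun n => (n, M)), ?_⟩
  ext n
  simp only [Set.mem_ofPred_eq, Set.mem_iUnion, Finset.mem_union, Finset.mem_image,
    Finset.mem_filter, Finset.mem_range, Finset.mem_Ico, exists_prop]
  constructor
  · intro hn
    by_cases hN : n < N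
    · exact ⟨(n, 0), Or.inl ⟨n, ⟨hN, hn⟩, rfl⟩, 0, by simp⟩
    · have hlt := Nat.mod_lt (n - N) hM
      have e : n = (N + (n - N) % M) + M * ((n - N) / M) := by
        rw [Nat.add_assoc, Nat.mod_add_div]; omega
      refine ⟨(N + (n - N) % M, M), Or.inr ⟨_, ⟨⟨by omega, by omega⟩, ?_⟩, rfl⟩, _, e⟩
      rw [← iter h ((n - N) / M) _ (by omega), ← e]
      exact hn
  · rintro ⟨p, (⟨x, ⟨-, hx⟩, rfl⟩ | ⟨x, ⟨hx', hx⟩, rfl⟩), k, rfl⟩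
    · simpa using hx
    · exact (iter h k x hx'.1).2 hx

end EvPer

section local_ring
variable {R : Type*} [CommRing R]

/-- eventually periodic modulo `c` -/
lemma pow_evper (c : R) [Finite (R ⧸ Ideal.span {c})] (d : R) :
    ∃ N M : ℕ, 0 < M ∧ ∀ n, N ≤ n → c ∣ d ^ (n + M) - d ^ n := by
  obtain ⟨i, j, hij, h⟩ := Finite.exists_ne_map_eq_of_infinite
    (fun n : ℕ => Ideal.Quotient.mk (Ideal.span {c}) d ^ n)
  wlog hlt : i < j generalizing i j
  · exact this j i hij.symm h.symm (by omega)
  refine ⟨i, j - i, by omega, fun n hn => ?_⟩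
  rw [← Ideal.mem_span_singleton, ← Ideal.Quotient.eq]
  rw [map_pow, map_pow]
  obtain ⟨k, rfl⟩ := Nat.exists_eq_add_of_le hn
  have : i + k + (j - i) = j + k := by omega
  have h' : Ideal.Quotient.mk (Ideal.span {c}) d ^ i = Ideal.Quotient.mk (Ideal.span {c}) d ^ j := h
  rw [this, pow_add, pow_add, h']

lemma pow_unit_per (c : R) [Finite (R ⧸ Ideal.span {c})] {d : R} (hd : IsUnit d) :
    ∃ M : ℕ, 0 < M ∧ c ∣ d ^ M - 1 := by
  obtain ⟨N, M, hM, h⟩ := pow_evper c d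
  refine ⟨M, hM, ?_⟩
  have := h N le_rfl
  rw [pow_add, ← mul_sub_one] at this
  exact (hd.pow N).dvd_mul_left.1 this

lemma pow_unit_per₂ (c : R) [Finite (R ⧸ Ideal.span {c})] {d e : R} (hd : IsUnit d)
    (he : IsUnit e) : ∃ M : ℕ, 0 < M ∧ c ∣ d ^ M - 1 ∧ c ∣ e ^ M - 1 := by
  obtain ⟨M, hM, h⟩ := pow_unit_per c hd
  obtain ⟨M', hM', h'⟩ := pow_unit_per c he
  refine ⟨M * M', by positivity, ?_, ?_⟩
  · rw [pow_mul]; exact h.trans (sub_one_dvd_pow_sub_one _ _)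
  · rw [mul_comm, pow_mul]; exact h'.trans (sub_one_dvd_pow_sub_one _ _)


/-- The divisibility condition. -/
def GCond (I : Ideal R) (a b x y : R) : Prop := b * x - a * y ∈ I * Ideal.span {x, y}

lemma GCond.symm_iff (I : Ideal R) (a b x y : R) : GCond I a b x y ↔ GCond I b a y x := by
  unfold GCond
  rw [Set.pair_comm, ← neg_mem_iff, neg_sub]

lemma gcond_iff {κ a b x y g : R} (h : Ideal.span {x, y} = Ideal.span {g}) :
    GCond (Ideal.span {κ}) a b x y ↔ κ * g ∣ b * x - a * y := by
  unfold GCond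
  rw [h, Ideal.span_singleton_mul_span_singleton, Ideal.mem_span_singleton]

lemma span_pair_eq_of_dvd {x y g : R} (hx : g ∣ x) (hy : g ∣ y)
    (hg : g ∈ Ideal.span {x, y}) : Ideal.span {x, y} = Ideal.span {g} := by
  apply le_antisymm
  · rw [Ideal.span_le]
    rintro z (rfl | rfl)
    · exact Ideal.mem_span_singleton.2 hx
    · exact Ideal.mem_span_singleton.2 hy
  · rwa [Ideal.span_singleton_le_iff_mem]

lemma bounded_case (κ a b : R) (x y : ℕ → R) (c : R)
    (hper : ∃ N M : ℕ, 0 < M ∧ ∀ n, N ≤ n →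
      κ * c ∣ x (n + M) - x n ∧ κ * c ∣ y (n + M) - y n)
    (N₀ : ℕ) (hc : ∀ n, N₀ ≤ n → c ∈ Ideal.span {x n, y n}) :
    EvPer (fun n => GCond (Ideal.span {κ}) a b (x n) (y n)) := by
  obtain ⟨N, M, hM, h⟩ := hper
  refine ⟨N + N₀, M, hM, fun n hn => ?_⟩
  obtain ⟨⟨u, hu⟩, ⟨v, hv⟩⟩ := h n (by omega)
  have hc1 := hc n (by omega)
  have hc2 := hc (n + M) (by omega)
  have ex : x (n + M) = x n + κ * u * c := by linear_combination hu
  have ey : y (n + M) = y n + κ * v * c := by linear_combination hv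
  have hI : Ideal.span {x (n + M), y (n + M)} = Ideal.span {x n, y n} := by
    apply le_antisymm
    · rw [Ideal.span_le]
      rintro z (rfl | rfl)
      · rw [ex]
        exact add_mem (Ideal.subset_span (by simp)) (Ideal.mul_mem_left _ _ hc1)
      · rw [ey]
        exact add_mem (Ideal.subset_span (by simp)) (Ideal.mul_mem_left _ _ hc1)
    · rw [Ideal.span_le]
      rintro z (rfl | rfl)
      · rw [show x n = x (n + M) - κ * u * c by linear_combination -ex]
        exact sub_mem (Ideal.subset_span (by simp)) (Ideal.mul_mem_left _ _ hc2)
      · rw [show y n = y (n + M) - κ * v * c by linear_combination -ey]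
        exact sub_mem (Ideal.subset_span (by simp)) (Ideal.mul_mem_left _ _ hc2)
  unfold GCond
  beta_reduce
  rw [hI, show b * x (n + M) - a * y (n + M) =
    (b * x n - a * y n) + (b * u - a * v) * (κ * c) by rw [ex, ey]; ring]
  exact add_mem_cancel_right (Ideal.mul_mem_left _ _
    (Ideal.mul_mem_mul (Ideal.mem_span_singleton_self _) hc1))

lemma factorial_dvd_pow [IsLocalRing R] {p : ℕ} (hp : p.Prime) (hpu : ¬ IsUnit (p : R)) (k : ℕ) :
    ((Nat.factorial (k + 1) : ℕ) : R) ∣ (p : R) ^ k := by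
  have := Fact.mk hp
  have hne : Nat.factorial (k + 1) ≠ 0 := Nat.factorial_ne_zero _
  have hlt := padicValNat_factorial_lt_of_ne_zero p (n := k + 1) (by omega)
  obtain ⟨e, m, hm, hfac⟩ := Nat.exists_eq_pow_mul_and_not_dvd hne p hp.ne_one
  have he : e ≤ k := by
    have h1 : p ^ e ∣ Nat.factorial (k + 1) := ⟨m, hfac⟩
    have := (padicValNat_dvd_iff_le hne).1 h1
    omega
  have hcop : IsCoprime (m : ℤ) (p : ℤ) :=
    Nat.isCoprime_iff_coprime.2 ((Nat.Prime.coprime_iff_not_dvd hp).2 hm).symm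
  have hmu : IsUnit (m : R) := by
    obtain ⟨u, v, huv⟩ := hcop
    have h2 : (u : R) * m + v * p = 1 := by exact_mod_cast congrArg (Int.cast : ℤ → R) huv
    by_contra hmn
    have h3 : (1 : R) ∈ IsLocalRing.maximalIdeal R := by
      rw [← h2]
      exact add_mem (Ideal.mul_mem_left _ _ hmn) (Ideal.mul_mem_left _ _ hpu)
    exact h3 isUnit_one
  rw [hfac]
  push_cast
  rw [hmu.mul_right_dvd]
  exact pow_dvd_pow _ he

lemma lte_lemma [IsLocalRing R] {p : ℕ} (hp : p.Prime) (hpu : ¬ IsUnit (p : R)) {κ w : R}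
    (hw : κ * p ^ 2 ∣ w) (t : ℕ) :
    ∃ g, (1 + w) ^ t - 1 = t * w * (1 + κ * p * g) := by
  obtain ⟨w', rfl⟩ := hw
  set w := κ * (p : R) ^ 2 * w' with hwdef
  cases t with
  | zero => exact ⟨0, by simp⟩
  | succ t =>
    have hk : ∀ k : ℕ, ∃ g, w ^ (k + 1) = ((k + 1 + 1 : ℕ) : R) * (κ * p * g) := by
      intro k
      have h1 : ((k + 1 + 1 : ℕ) : R) ∣ (p : R) ^ (k + 1) :=
        (Nat.cast_dvd_cast (Nat.dvd_factorial (by omega) le_rfl)).trans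
          (factorial_dvd_pow hp hpu (k + 1))
      obtain ⟨q, hq⟩ := h1
      refine ⟨(κ * p) ^ k * w' ^ (k + 1) * q, ?_⟩
      rw [hwdef, show κ * (p : R) ^ 2 * w' = (κ * p) * w' * p by ring, mul_pow, hq]
      ring
    choose g hg using hk
    refine ⟨∑ k ∈ Finset.range t, (Nat.choose t (k + 1) : R) * g k, ?_⟩
    rw [add_comm 1 w, add_pow, Finset.sum_range_succ', Finset.sum_range_succ']
    have : ∀ k ∈ Finset.range t, w ^ (k + 1 + 1) * 1 ^ (t + 1 - (k + 1 + 1)) *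
        ((t + 1).choose (k + 1 + 1) : R) =
        ((t + 1 : ℕ) : R) * w * (κ * p) * ((Nat.choose t (k + 1) : R) * g k) := by
      intro k _
      have h2 : ((t + 1 : ℕ) : R) * (t.choose (k + 1) : R) =
          ((t + 1).choose (k + 1 + 1) : R) * ((k + 1 + 1 : ℕ) : R) := by
        exact_mod_cast congrArg (Nat.cast : ℕ → R) (Nat.add_one_mul_choose_eq t (k + 1))
      rw [pow_succ w (k + 1), hg]
      linear_combination (- κ * p * g k * w) * h2
    rw [Finset.sum_congr rfl this, ← Finset.mul_sum]
    simp
    ring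

/-- One residue class, all bases being principal units. -/
lemma class_case [IsDomain R] [ValuationRing R] [CharZero R]
    (hfin : ∀ c : R, c ≠ 0 → Finite (R ⧸ Ideal.span {c}))
    {p : ℕ} (hp : p.Prime) (hpu : ¬ IsUnit (p : R)) {κ : R} (hκ : κ ≠ 0)
    (a b d u v α β : R) (hu : IsUnit u) (hv : IsUnit v) (hα : IsUnit α) (hβ : IsUnit β)
    (hα1 : κ * p ^ 2 ∣ α - 1) (hβ1 : κ * p ^ 2 ∣ β - 1) :
    EvPer (fun m => GCond (Ideal.span {κ}) a b (u * α ^ m - d) (v * β ^ m - d)) := by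
  wlog hdiv : α - 1 ∣ β - 1 generalizing a b u v α β
  · have h := this b a v u β α hv hu hβ hα hβ1 hα1
      ((ValuationRing.dvd_total (α - 1) (β - 1)).resolve_left hdiv)
    exact EvPer.congr_ev 0 (fun n _ => GCond.symm_iff _ _ _ _ _) h
  have hp0 : (p : R) ≠ 0 := by exact_mod_cast hp.ne_zero
  by_cases hw0 : α - 1 = 0
  · have h1 : α = 1 := sub_eq_zero.1 hw0
    have h2 : β = 1 := by rw [hw0, zero_dvd_iff] at hdiv; exact sub_eq_zero.1 hdiv
    subst h1; subst h2
    simp only [one_pow]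
    exact EvPer.const _
  obtain ⟨q, hq⟩ := hdiv
  by_cases hbd : ∃ c : R, c ≠ 0 ∧ ∀ m, c ∈ Ideal.span {u * α ^ m - d, v * β ^ m - d}
  · obtain ⟨c, hc0, hc⟩ := hbd
    refine bounded_case κ a b _ _ c ?_ 0 (fun n _ => hc n)
    have := hfin (κ * c) (mul_ne_zero hκ hc0)
    obtain ⟨M, hM, h1, h2⟩ := pow_unit_per₂ (κ * c) hα hβ
    refine ⟨0, M, hM, fun n _ => ⟨?_, ?_⟩⟩
    · rw [show u * α ^ (n + M) - d - (u * α ^ n - d) = u * α ^ n * (α ^ M - 1) by ring]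
      exact h1.mul_left _
    · rw [show v * β ^ (n + M) - d - (v * β ^ n - d) = v * β ^ n * (β ^ M - 1) by ring]
      exact h2.mul_left _
  · push Not at hbd
    -- arbitrarily good approximate zeros
    have happ : ∀ c : R, c ≠ 0 → ∀ m : ℕ, ∃ t : ℕ, 0 < t ∧ c ∣ u * α ^ (m + t) - d ∧
        c ∣ v * β ^ (m + t) - d := by
      intro c hc m
      obtain ⟨m₁, hm₁⟩ := hbd c hc
      have hx : c ∣ u * α ^ m₁ - d := by
        refine (ValuationRing.dvd_total _ _).resolve_right fun h => hm₁ ?_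
        exact Ideal.mem_of_dvd _ h (Ideal.subset_span (by simp))
      have hy : c ∣ v * β ^ m₁ - d := by
        refine (ValuationRing.dvd_total _ _).resolve_right fun h => hm₁ ?_
        exact Ideal.mem_of_dvd _ h (Ideal.subset_span (by simp))
      have := hfin c hc
      obtain ⟨M, hM, h1, h2⟩ := pow_unit_per₂ c hα hβ
      have hlt : m < m₁ + M * (m + 1) := by nlinarith
      refine ⟨m₁ + M * (m + 1) - m, by omega, ?_, ?_⟩
      · rw [show m + (m₁ + M * (m + 1) - m) = m₁ + M * (m + 1) by omega,
          show u * α ^ (m₁ + M * (m + 1)) - d = (u * α ^ m₁ - d) +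
            u * α ^ m₁ * ((α ^ M) ^ (m + 1) - 1) by rw [pow_add, pow_mul]; ring]
        exact dvd_add hx ((h1.trans (sub_one_dvd_pow_sub_one _ _)).mul_left _)
      · rw [show m + (m₁ + M * (m + 1) - m) = m₁ + M * (m + 1) by omega,
          show v * β ^ (m₁ + M * (m + 1)) - d = (v * β ^ m₁ - d) +
            v * β ^ m₁ * ((β ^ M) ^ (m + 1) - 1) by rw [pow_add, pow_mul]; ring]
        exact dvd_add hy ((h2.trans (sub_one_dvd_pow_sub_one _ _)).mul_left _)
    have hunit : ∀ g : R, IsUnit (1 + κ * p * g) := by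
      intro g
      by_contra hn
      have h3 : (1 : R) ∈ IsLocalRing.maximalIdeal R := by
        rw [show (1 : R) = (1 + κ * p * g) - (κ * g) * p by ring]
        exact sub_mem hn (Ideal.mul_mem_left _ _ hpu)
      exact h3 isUnit_one
    have hunit' : ∀ g : R, IsUnit (1 - p * g) := by
      intro g
      by_contra hn
      have h3 : (1 : R) ∈ IsLocalRing.maximalIdeal R := by
        rw [show (1 : R) = (1 - p * g) + g * p by ring]
        exact add_mem hn (Ideal.mul_mem_left _ _ hpu)
      exact h3 isUnit_one
    have key : ∀ m : ℕ, (u * α ^ m - d ≠ 0 ∨ v * β ^ m - d ≠ 0) →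
        (GCond (Ideal.span {κ}) a b (u * α ^ m - d) (v * β ^ m - d) ↔
          κ ∣ b * u - a * v * q) := by
      intro m hm
      set x := u * α ^ m - d with hx
      set y := v * β ^ m - d with hy
      obtain ⟨g, hg0, hgx, hgy, hgI⟩ : ∃ g : R, g ≠ 0 ∧ g ∣ x ∧ g ∣ y ∧
          g ∈ Ideal.span {x, y} := by
        rcases ValuationRing.dvd_total x y with h | h
        · refine ⟨x, fun h0 => ?_, dvd_rfl, h, Ideal.subset_span (by simp)⟩
          rw [h0, zero_dvd_iff] at h
          tauto
        · refine ⟨y, fun h0 => ?_, h, dvd_rfl, Ideal.subset_span (by simp)⟩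
          rw [h0, zero_dvd_iff] at h
          tauto
      obtain ⟨t, ht, ⟨X, hX⟩, ⟨Y, hY⟩⟩ :=
        happ (κ * p * g) (mul_ne_zero (mul_ne_zero hκ hp0) hg0) m
      obtain ⟨g₁, hg₁⟩ := lte_lemma hp hpu hα1 t
      obtain ⟨g₂, hg₂⟩ := lte_lemma hp hpu hβ1 t
      rw [add_sub_cancel] at hg₁ hg₂
      set τ : R := t * (α - 1) with hτ
      have hτ0 : τ ≠ 0 := mul_ne_zero (by exact_mod_cast ht.ne') hw0
      have ex : x = κ * p * g * X - u * α ^ m * τ * (1 + κ * p * g₁) := by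
        rw [← hX, hx, pow_add]
        linear_combination (-u * α ^ m) * hg₁
      have ey : y = κ * p * g * Y - v * β ^ m * τ * q * (1 + κ * p * g₂) := by
        rw [← hY, hy, pow_add]
        rw [hq] at hg₂
        linear_combination (-v * β ^ m) * hg₂
      have hgτ : g ∣ τ := by
        have h1 : g ∣ (u * α ^ m * (1 + κ * p * g₁)) * τ := by
          rw [show (u * α ^ m * (1 + κ * p * g₁)) * τ = g * (κ * p * X) - x by rw [ex]; ring]
          exact dvd_sub (dvd_mul_right _ _) hgx
        exact ((hu.mul (hα.pow m)).mul (hunit g₁)).dvd_mul_left.1 h1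
      have hτg : τ ∣ g := by
        obtain ⟨e, f, hef⟩ := Ideal.mem_span_pair.1 hgI
        have h1 : τ ∣ (1 - p * (κ * (e * X + f * Y))) * g := by
          refine ⟨-(e * (u * α ^ m * (1 + κ * p * g₁)) +
            f * (v * β ^ m * q * (1 + κ * p * g₂))), ?_⟩
          rw [ex, ey] at hef
          linear_combination -hef
        exact (hunit' _).dvd_mul_left.1 h1
      rw [gcond_iff (span_pair_eq_of_dvd hgx hgy hgI)]
      have hassoc : κ * g ∣ b * x - a * y ↔ κ * τ ∣ b * x - a * y :=
        ⟨(mul_dvd_mul_left κ hτg).trans, (mul_dvd_mul_left κ hgτ).trans⟩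
      rw [hassoc]
      obtain ⟨e, he⟩ := hτg
      obtain ⟨A, hA⟩ := (Dvd.intro _ rfl : κ ∣ κ * (p : R) ^ 2).trans
        (hα1.trans (sub_one_dvd_pow_sub_one α m))
      obtain ⟨B, hB⟩ := (Dvd.intro _ rfl : κ ∣ κ * (p : R) ^ 2).trans
        (hβ1.trans (sub_one_dvd_pow_sub_one β m))
      have hA' : α ^ m = 1 + κ * A := by linear_combination hA
      have hB' : β ^ m = 1 + κ * B := by linear_combination hB
      have e1 : b * x - a * y = τ * (-(b * u - a * v * q) + κ * (p * e * (b * X - a * Y)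
          - b * u * A - b * u * (1 + κ * A) * p * g₁
          + a * v * q * B + a * v * q * (1 + κ * B) * p * g₂)) := by
        rw [ex, ey, hA', hB', he]; ring
      rw [e1, mul_comm κ τ, mul_dvd_mul_iff_left hτ0, dvd_add_left (dvd_mul_right _ _), dvd_neg]
    -- at most one common zero
    have hev : ∃ N : ℕ, ∀ m, N ≤ m → (u * α ^ m - d ≠ 0 ∨ v * β ^ m - d ≠ 0) := by
      by_cases hz : ∃ m₀, u * α ^ m₀ - d = 0
      · obtain ⟨m₀, hm₀⟩ := hz
        refine ⟨m₀ + 1, fun m hm => Or.inl fun h => ?_⟩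
        obtain ⟨t, rfl⟩ := Nat.exists_eq_add_of_le (show m₀ ≤ m by omega)
        obtain ⟨g₁, hg₁⟩ := lte_lemma hp hpu hα1 t
        rw [add_sub_cancel] at hg₁
        have h1 : u * α ^ m₀ * ((t : R) * (α - 1) * (1 + κ * p * g₁)) = 0 := by
          rw [← hg₁]
          rw [pow_add] at h
          linear_combination h - hm₀
        have ht : (t : R) ≠ 0 := by
          have : t ≠ 0 := by omega
          exact_mod_cast this
        exact mul_ne_zero (mul_ne_zero hu.ne_zero (hα.pow m₀).ne_zero)
          (mul_ne_zero (mul_ne_zero ht hw0) (hunit g₁).ne_zero) h1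
      · push Not at hz
        exact ⟨0, fun m _ => Or.inl (hz m)⟩
    obtain ⟨N, hN⟩ := hev
    exact EvPer.congr_ev N (fun m hm => key m (hN m hm)) (EvPer.const _)

lemma bounded_pow [IsDomain R] (hfin : ∀ c : R, c ≠ 0 → Finite (R ⧸ Ideal.span {c}))
    {κ : R} (hκ : κ ≠ 0) (a b d₁ d₂ d₃ : R) {c : R} (hc0 : c ≠ 0) (N₀ : ℕ)
    (hc : ∀ n, N₀ ≤ n → c ∈ Ideal.span {d₁ ^ n - d₃, d₂ ^ n - d₃}) :
    EvPer (fun n => GCond (Ideal.span {κ}) a b (d₁ ^ n - d₃) (d₂ ^ n - d₃)) := by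
  refine bounded_case κ a b _ _ c ?_ N₀ hc
  have := hfin (κ * c) (mul_ne_zero hκ hc0)
  obtain ⟨N, M, hM, h⟩ := pow_evper (κ * c) d₁
  obtain ⟨N', M', hM', h'⟩ := pow_evper (κ * c) d₂
  have mult : ∀ (d : R) (N M : ℕ), (∀ n, N ≤ n → κ * c ∣ d ^ (n + M) - d ^ n) →
      ∀ k n, N ≤ n → κ * c ∣ d ^ (n + M * k) - d ^ n := by
    intro d N M h k
    induction k with
    | zero => intro n _; simp
    | succ k ih =>
      intro n hn
      have := dvd_add (h (n + M * k) (by omega)) (ih n hn)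
      rw [sub_add_sub_cancel] at this
      rw [Nat.mul_succ, ← Nat.add_assoc]
      exact this
  refine ⟨N + N', M * M', by positivity, fun n hn => ⟨?_, ?_⟩⟩
  · rw [sub_sub_sub_cancel_right]
    exact mult d₁ N M h M' n (by omega)
  · rw [sub_sub_sub_cancel_right, mul_comm M M']
    exact mult d₂ N' M' h' M n (by omega)

lemma nonunit_case [IsDomain R] [IsLocalRing R]
    (hfin : ∀ c : R, c ≠ 0 → Finite (R ⧸ Ideal.span {c}))
    (d₁ d₃ : R) (hd₁ : ¬ IsUnit d₁) (hd₃ : d₃ ≠ 0) :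
    ∃ N₀ : ℕ, ∀ n, N₀ ≤ n → d₁ ^ n - d₃ ∣ d₃ := by
  by_cases h0 : d₁ = 0
  · refine ⟨1, fun n hn => ?_⟩
    rw [h0, zero_pow (by omega), zero_sub, neg_dvd]
  · have := hfin (d₃ * d₁) (mul_ne_zero hd₃ h0)
    obtain ⟨N, M, hM, h⟩ := pow_evper (d₃ * d₁) d₁
    refine ⟨N, fun n hn => ?_⟩
    have hun : ∀ z, IsUnit (d₁ * z - 1) := by
      intro z
      by_contra hn
      have h3 : (1 : R) ∈ IsLocalRing.maximalIdeal R := by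
        rw [show (1 : R) = z * d₁ - (d₁ * z - 1) by ring]
        exact sub_mem (Ideal.mul_mem_left _ _ hd₁) hn
      exact h3 isUnit_one
    have h1 := h n hn
    rw [pow_add, ← mul_sub_one] at h1
    have h2 : IsUnit (d₁ ^ M - 1) := by
      obtain ⟨k, rfl⟩ := Nat.exists_eq_add_of_lt hM
      rw [show d₁ ^ (0 + k + 1) = d₁ * d₁ ^ k by ring]
      exact hun _
    obtain ⟨e, he⟩ := h2.dvd_mul_right.1 h1
    rw [he, show d₃ * d₁ * e - d₃ = d₃ * (d₁ * e - 1) by ring]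
    exact (hun e).mul_right_dvd.2 dvd_rfl

lemma local_main [IsDomain R] [ValuationRing R] [CharZero R]
    (hfin : ∀ c : R, c ≠ 0 → Finite (R ⧸ Ideal.span {c}))
    {p : ℕ} (hp : p.Prime) (hpu : ¬ IsUnit (p : R)) {κ : R} (hκ : κ ≠ 0)
    (a b d₁ d₂ d₃ : R) :
    EvPer (fun n => GCond (Ideal.span {κ}) a b (d₁ ^ n - d₃) (d₂ ^ n - d₃)) := by
  have hp0 : (p : R) ≠ 0 := by exact_mod_cast hp.ne_zero
  by_cases hd₃ : d₃ = 0
  · subst hd₃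
    simp only [sub_zero]
    wlog hdiv : d₁ ∣ d₂ generalizing a b d₁ d₂
    · have h := this b a d₂ d₁ ((ValuationRing.dvd_total d₁ d₂).resolve_left hdiv)
      exact EvPer.congr_ev 0 (fun n _ => GCond.symm_iff _ _ _ _ _) h
    obtain ⟨z, rfl⟩ := hdiv
    by_cases h1 : d₁ = 0
    · subst h1
      refine EvPer.congr_ev 1 (fun n hn => ?_) (EvPer.const True)
      rw [zero_mul, zero_pow (by omega)]
      simp [GCond]
    · have hiff : ∀ n, GCond (Ideal.span {κ}) a b (d₁ ^ n) ((d₁ * z) ^ n) ↔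
          κ ∣ b - a * z ^ n := by
        intro n
        rw [gcond_iff (span_pair_eq_of_dvd (g := d₁ ^ n) dvd_rfl
          (by rw [mul_pow]; exact dvd_mul_right _ _) (Ideal.subset_span (by simp))),
          show b * d₁ ^ n - a * (d₁ * z) ^ n = d₁ ^ n * (b - a * z ^ n) by rw [mul_pow]; ring,
          mul_comm κ, mul_dvd_mul_iff_left (pow_ne_zero _ h1)]
      have := hfin κ hκ
      obtain ⟨N, M, hM, h⟩ := pow_evper κ z
      refine ⟨N, M, hM, fun n hn => ?_⟩
      beta_reduce
      rw [hiff, hiff, show b - a * z ^ (n + M) = (b - a * z ^ n) - a * (z ^ (n + M) - z ^ n) by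
        ring]
      exact dvd_sub_left ((h n hn).mul_left _)
  · by_cases h1 : IsUnit d₁
    · by_cases h2 : IsUnit d₂
      · have hc : κ * (p : R) ^ 2 ≠ 0 := mul_ne_zero hκ (pow_ne_zero _ hp0)
        have := hfin _ hc
        obtain ⟨T, hT, hT1, hT2⟩ := pow_unit_per₂ (κ * (p : R) ^ 2) h1 h2
        refine EvPer.of_classes T hT fun r => ?_
        have := class_case hfin hp hpu hκ a b d₃ (d₁ ^ r) (d₂ ^ r) (d₁ ^ T) (d₂ ^ T)
          (h1.pow _) (h2.pow _) (h1.pow _) (h2.pow _) hT1 hT2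
        simpa only [pow_add, pow_mul] using this
      · obtain ⟨N₀, hN⟩ := nonunit_case hfin d₂ d₃ h2 hd₃
        exact bounded_pow hfin hκ a b d₁ d₂ d₃ hd₃ N₀ fun n hn =>
          Ideal.mem_of_dvd _ (hN n hn) (Ideal.subset_span (by simp))
    · obtain ⟨N₀, hN⟩ := nonunit_case hfin d₁ d₃ h1 hd₃
      exact bounded_pow hfin hκ a b d₁ d₂ d₃ hd₃ N₀ fun n hn =>
        Ideal.mem_of_dvd _ (hN n hn) (Ideal.subset_span (by simp))

open Polynomial in
lemma sml_poly [IsDomain R] [IsLocalRing R] {p : ℕ} (hp : p.Prime) (hpu : ¬ IsUnit (p : R))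
    {x y c₁ c₂ δ : R} (hx : (p : R) ^ 3 ∣ x) (hy : (p : R) ^ 3 ∣ y)
    (h1 : δ ∣ c₁ * x + c₂ * y) (h2 : δ ∣ c₁ * x ^ 2 + c₂ * y ^ 2) (N : ℕ) :
    ∃ Q : R[X], ∀ s : ℕ, s ≤ N →
      2 * (c₁ * (1 + x) ^ s + c₂ * (1 + y) ^ s - (c₁ + c₂)) =
        s * (2 * (c₁ * x + c₂ * y) + (s - 1) * (c₁ * x ^ 2 + c₂ * y ^ 2)
          + 2 * p * δ * Q.eval (s : R)) := by
  have hΔ : ∀ k : ℕ, (p : R) ^ (3 * k) * δ ∣ c₁ * x ^ (k + 2) + c₂ * y ^ (k + 2) ∧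
      (p : R) ^ (3 * (k + 1)) * δ ∣ c₁ * x ^ (k + 3) + c₂ * y ^ (k + 3) := by
    obtain ⟨x', hx'⟩ := hx
    obtain ⟨y', hy'⟩ := hy
    intro k
    induction k with
    | zero =>
      refine ⟨by simpa using h2, ?_⟩
      obtain ⟨u, hu⟩ := h1
      obtain ⟨v, hv⟩ := h2
      refine ⟨(x' + y') * v - x' * y' * p ^ 3 * u, ?_⟩
      have e : c₁ * x ^ (0 + 3) + c₂ * y ^ (0 + 3) =
        (x + y) * (c₁ * x ^ 2 + c₂ * y ^ 2) - x * y * (c₁ * x + c₂ * y) := by ring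
      rw [e, hu, hv, hx', hy']
      ring
    | succ k ih =>
      refine ⟨ih.2, ?_⟩
      obtain ⟨⟨u, hu⟩, ⟨v, hv⟩⟩ := ih
      refine ⟨(x' + y') * v - x' * y' * u, ?_⟩
      have e : c₁ * x ^ (k + 1 + 3) + c₂ * y ^ (k + 1 + 3) =
        (x + y) * (c₁ * x ^ (k + 3) + c₂ * y ^ (k + 3))
          - x * y * (c₁ * x ^ (k + 2) + c₂ * y ^ (k + 2)) := by ring
      rw [e, hu, hv, hx', hy']
      ring
  have hg : ∀ k : ℕ, ∃ g, c₁ * x ^ (k + 3) + c₂ * y ^ (k + 3) =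
      ((Nat.factorial (k + 3) : ℕ) : R) * (p * δ * g) := by
    intro k
    obtain ⟨u, hu⟩ := (hΔ k).2
    obtain ⟨q, hq⟩ := factorial_dvd_pow (R := R) hp hpu (k + 2)
    refine ⟨p ^ (2 * k) * u * q, ?_⟩
    rw [hu, show 3 * (k + 1) = (k + 2) + 1 + 2 * k by ring, pow_add, pow_add, hq]
    ring
  choose g hg using hg
  refine ⟨∑ k ∈ Finset.range N, C (g k) * (descPochhammer R (k + 2)).comp (X - 1), ?_⟩
  intro s hs
  have hexp : ∀ z : R, (1 + z) ^ s = ∑ k ∈ Finset.range (N + 3), z ^ k * (s.choose k : R) := by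
    intro z
    rw [add_comm 1 z, add_pow]
    simp only [one_pow, mul_one]
    apply Finset.sum_subset
    · intro k hk
      simp only [Finset.mem_range] at hk ⊢
      omega
    · intro k _ hk
      simp only [Finset.mem_range] at hk
      rw [Nat.choose_eq_zero_of_lt (by omega)]
      simp
  have hsum : c₁ * (1 + x) ^ s + c₂ * (1 + y) ^ s =
      ∑ k ∈ Finset.range (N + 3), (c₁ * x ^ k + c₂ * y ^ k) * (s.choose k : R) := by
    rw [hexp, hexp, Finset.mul_sum, Finset.mul_sum, ← Finset.sum_add_distrib]
    refine Finset.sum_congr rfl fun k _ => by ring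
  have hch2 : ∀ s : ℕ, 2 * (s.choose 2 : R) = s * (s - 1) := by
    intro s
    induction s with
    | zero => simp
    | succ s ih =>
      rw [Nat.choose_succ_succ' s 1, Nat.choose_one_right]
      push_cast
      linear_combination ih
  have hterm : ∀ k ∈ Finset.range N, (c₁ * x ^ (k + 1 + 1 + 1) + c₂ * y ^ (k + 1 + 1 + 1)) *
      (s.choose (k + 1 + 1 + 1) : R) =
      s * (p * δ) * (C (g k) * (descPochhammer R (k + 2)).comp (X - 1)).eval (s : R) := by
    intro k _
    have hd : ((Nat.factorial (k + 3) : ℕ) : R) * (s.choose (k + 3) : R) =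
        s * ((descPochhammer R (k + 2)).comp (X - 1)).eval (s : R) := by
      rw [← Nat.cast_mul, ← Nat.descFactorial_eq_factorial_mul_choose,
        ← descPochhammer_eval_eq_descFactorial, descPochhammer_succ_left]
      simp
    rw [eval_mul, eval_C]
    have := hg k
    linear_combination (s.choose (k + 3) : R) * this + p * δ * g k * hd
  rw [hsum, Finset.sum_range_succ', Finset.sum_range_succ', Finset.sum_range_succ',
    Finset.sum_congr rfl hterm, ← Finset.mul_sum, eval_finsetSum]
  simp only [zero_add, pow_zero, pow_one, Nat.choose_zero_right, Nat.choose_one_right,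
    Nat.reduceAdd, Nat.cast_one, mul_one]
  have := hch2 s
  linear_combination (c₁ * x ^ 2 + c₂ * y ^ 2) * this

lemma sml_three [IsDomain R] [ValuationRing R] [CharZero R]
    {p : ℕ} (hp : p.Prime) (hpu : ¬ IsUnit (p : R))
    {x y c₁ c₂ c₃ : R} (hx : (p : R) ^ 3 ∣ x) (hy : (p : R) ^ 3 ∣ y)
    (h0 : c₁ + c₂ + c₃ = 0) {s t : ℕ} (hs : 0 < s) (hst : s < t)
    (h1 : c₁ * (1 + x) ^ s + c₂ * (1 + y) ^ s + c₃ = 0)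
    (h2 : c₁ * (1 + x) ^ t + c₂ * (1 + y) ^ t + c₃ = 0) (m : ℕ) :
    c₁ * (1 + x) ^ m + c₂ * (1 + y) ^ m + c₃ = 0 := by
  by_cases hz : c₁ * x + c₂ * y = 0 ∧ c₁ * x ^ 2 + c₂ * y ^ 2 = 0
  · obtain ⟨Q, hQ⟩ := sml_poly hp hpu (δ := 0) hx hy (by rw [hz.1]) (by rw [hz.2]) m
    have := hQ m le_rfl
    rw [hz.1, hz.2] at this
    have h3 : 2 * (c₁ * (1 + x) ^ m + c₂ * (1 + y) ^ m + c₃) = 0 := by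
      linear_combination this + 2 * h0
    exact (mul_eq_zero.1 h3).resolve_left two_ne_zero
  · exfalso
    obtain ⟨δ, hδ0, hd1, hd2, hd⟩ : ∃ δ : R, δ ≠ 0 ∧ δ ∣ c₁ * x + c₂ * y ∧
        δ ∣ c₁ * x ^ 2 + c₂ * y ^ 2 ∧
        (δ = c₁ * x + c₂ * y ∨ δ = c₁ * x ^ 2 + c₂ * y ^ 2) := by
      rcases ValuationRing.dvd_total (c₁ * x + c₂ * y) (c₁ * x ^ 2 + c₂ * y ^ 2) with h | h
      · refine ⟨_, fun h0 => ?_, dvd_rfl, h, Or.inl rfl⟩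
        rw [h0, zero_dvd_iff] at h
        tauto
      · refine ⟨_, fun h0 => ?_, h, dvd_rfl, Or.inr rfl⟩
        rw [h0, zero_dvd_iff] at h
        tauto
    obtain ⟨Q, hQ⟩ := sml_poly hp hpu hx hy hd1 hd2 t
    have es := hQ s hst.le
    have et := hQ t le_rfl
    set A := c₁ * x + c₂ * y
    set B := c₁ * x ^ 2 + c₂ * y ^ 2
    have hs0 : (s : R) ≠ 0 := by exact_mod_cast hs.ne'
    have ht0 : (t : R) ≠ 0 := by exact_mod_cast (hs.trans hst).ne'
    have es' : 2 * A + (s - 1) * B + 2 * p * δ * Q.eval (s : R) = 0 := by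
      refine (mul_eq_zero.1 ?_).resolve_left hs0
      rw [← es]; linear_combination 2 * h1 - 2 * h0
    have et' : 2 * A + (t - 1) * B + 2 * p * δ * Q.eval (t : R) = 0 := by
      refine (mul_eq_zero.1 ?_).resolve_left ht0
      rw [← et]; linear_combination 2 * h2 - 2 * h0
    obtain ⟨e, he⟩ := Polynomial.sub_dvd_eval_sub (t : R) (s : R) Q
    have hts : (t : R) - s ≠ 0 := by
      rw [sub_ne_zero]; exact_mod_cast hst.ne'
    have eB : B = 2 * (p * δ * -e) := by
      have : ((t : R) - s) * (B + 2 * p * δ * e) = 0 := by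
        linear_combination et' - es' - 2 * p * δ * he
      linear_combination (mul_eq_zero.1 this).resolve_left hts
    have eA : A = p * δ * ((s - 1) * e - Q.eval (s : R)) := by
      apply mul_left_cancel₀ (two_ne_zero (α := R))
      linear_combination es' - (s - 1) * eB
    have hdvd : (p : R) * δ ∣ δ := by
      rcases hd with h | h
      · nth_rw 2 [h]; rw [eA]; exact dvd_mul_right _ _
      · nth_rw 2 [h]; rw [eB]; exact (dvd_mul_right _ _).mul_left _
    nth_rw 2 [← one_mul δ] at hdvd
    rw [mul_dvd_mul_iff_right hδ0] at hdvd
    exact hpu (isUnit_of_dvd_one hdvd)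

lemma sml_local [IsDomain R] [ValuationRing R] [CharZero R]
    (hfin : ∀ c : R, c ≠ 0 → Finite (R ⧸ Ideal.span {c}))
    {p : ℕ} (hp : p.Prime) (hpu : ¬ IsUnit (p : R)) (c₁ c₂ c₃ d₁ d₂ : R)
    (hd₁ : IsUnit d₁) (hd₂ : IsUnit d₂) :
    EvPer (fun n => c₁ * d₁ ^ n + c₂ * d₂ ^ n + c₃ = 0) := by
  have hp0 : (p : R) ≠ 0 := by exact_mod_cast hp.ne_zero
  have := hfin _ (pow_ne_zero 3 hp0)
  obtain ⟨T, hT, h1, h2⟩ := pow_unit_per₂ ((p : R) ^ 3) hd₁ hd₂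
  refine EvPer.of_classes T hT fun r => ?_
  set α := d₁ ^ T with hα
  set β := d₂ ^ T with hβ
  have hf : ∀ m, c₁ * d₁ ^ (r + T * m) + c₂ * d₂ ^ (r + T * m) + c₃ =
      c₁ * d₁ ^ r * (1 + (α - 1)) ^ m + c₂ * d₂ ^ r * (1 + (β - 1)) ^ m + c₃ := by
    intro m
    rw [add_sub_cancel, add_sub_cancel, hα, hβ, pow_add, pow_add, pow_mul, pow_mul]
    ring
  simp only [hf]
  by_cases hN : ∃ N, ∀ m, N ≤ m →
      c₁ * d₁ ^ r * (1 + (α - 1)) ^ m + c₂ * d₂ ^ r * (1 + (β - 1)) ^ m + c₃ ≠ 0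
  · obtain ⟨N, hN⟩ := hN
    exact EvPer.congr_ev N (fun m hm => iff_false_intro (hN m hm)) (EvPer.const False)
  · push Not at hN
    obtain ⟨m₀, -, h₀⟩ := hN 0
    obtain ⟨m₁, hm₁, h₁⟩ := hN (m₀ + 1)
    obtain ⟨m₂, hm₂, h₂⟩ := hN (m₁ + 1)
    obtain ⟨s, rfl⟩ := Nat.exists_eq_add_of_le (show m₀ ≤ m₁ by omega)
    obtain ⟨t, rfl⟩ := Nat.exists_eq_add_of_le (show m₀ ≤ m₂ by omega)
    refine EvPer.congr_ev m₀ (fun m hm => iff_true_intro ?_) (EvPer.const True)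
    obtain ⟨k, rfl⟩ := Nat.exists_eq_add_of_le hm
    rw [pow_add, pow_add, ← mul_assoc, ← mul_assoc] at h₁ h₂ ⊢
    exact sml_three hp hpu h1 h2 h₀ (by omega) (by omega) h₁ h₂ k

end local_ring

section global_part
open NumberField

variable {K : Type*} [Field K] [NumberField K]

lemma loc_charZero (P : Ideal (𝓞 K)) [P.IsPrime] : CharZero (Localization.AtPrime P) :=
  charZero_of_injective_algebraMap
    (IsLocalization.injective (Localization.AtPrime P) P.primeCompl_le_nonZeroDivisors)

lemma loc_dvr (P : Ideal (𝓞 K)) [P.IsPrime] (hP : P ≠ ⊥) :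
    IsDiscreteValuationRing (Localization.AtPrime P) :=
  IsLocalization.AtPrime.isDiscreteValuationRing_of_dedekind_domain _ hP _

lemma loc_fin (P : Ideal (𝓞 K)) [P.IsPrime] (hP : P ≠ ⊥) (c : Localization.AtPrime P)
    (hc : c ≠ 0) : Finite (Localization.AtPrime P ⧸ Ideal.span {c}) := by
  have := loc_dvr P hP
  have : P.IsMaximal := Ring.HasFiniteQuotients.maximalOfPrime hP
  obtain ⟨ϖ, hϖ⟩ := IsDiscreteValuationRing.exists_irreducible (Localization.AtPrime P)
  obtain ⟨n, hn⟩ := IsDiscreteValuationRing.ideal_eq_span_pow_irreducible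
    (s := Ideal.span {c}) (by simpa using hc) hϖ
  rw [hn, ← Ideal.span_singleton_pow, ← hϖ.maximalIdeal_eq]
  have : Finite (𝓞 K ⧸ P ^ n) := Ring.HasFiniteQuotients.finiteQuotient (pow_ne_zero n hP)
  exact Finite.of_equiv _
    (IsLocalization.AtPrime.equivQuotMaximalIdealPow P (Localization.AtPrime P) n).toEquiv

lemma exists_prime_mem (P : Ideal (𝓞 K)) [P.IsPrime] (hP : P ≠ ⊥) :
    ∃ p : ℕ, p.Prime ∧ (p : 𝓞 K) ∈ P := by
  have : Finite (𝓞 K ⧸ P) := Ring.HasFiniteQuotients.finiteQuotient hP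
  obtain ⟨p, hp⟩ := CharP.exists (𝓞 K ⧸ P)
  refine ⟨p, (CharP.char_is_prime_or_zero (𝓞 K ⧸ P) p).resolve_right ?_, ?_⟩
  · rintro rfl
    have := CharP.charP_to_charZero (𝓞 K ⧸ P)
    exact not_finite (𝓞 K ⧸ P)
  · rw [← Ideal.Quotient.eq_zero_iff_mem, map_natCast]
    exact CharP.cast_eq_zero _ _

lemma not_isUnit_loc (P : Ideal (𝓞 K)) [P.IsPrime] {p : ℕ} (hp : (p : 𝓞 K) ∈ P) :
    ¬ IsUnit (p : Localization.AtPrime P) := by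
  rw [← map_natCast (algebraMap (𝓞 K) (Localization.AtPrime P)),
    IsLocalization.AtPrime.isUnit_to_map_iff (Localization.AtPrime P) P]
  exact fun h => h hp

lemma mem_iff_loc (I : Ideal (𝓞 K)) (z : 𝓞 K) :
    z ∈ I ↔ ∀ (P : Ideal (𝓞 K)) (_ : P.IsMaximal),
      algebraMap (𝓞 K) (Localization.AtPrime P) z ∈
        I.map (algebraMap (𝓞 K) (Localization.AtPrime P)) := by
  constructor
  · intro h P _
    exact Ideal.mem_map_of_mem _ h
  · intro h
    by_contra hz
    have hne : Submodule.colon I {z} ≠ ⊤ := by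
      intro ht
      apply hz
      have : (1 : 𝓞 K) ∈ Submodule.colon I {z} := by rw [ht]; trivial
      simpa [Submodule.mem_colon_singleton] using this
    obtain ⟨P, hP, hle⟩ := Ideal.exists_le_maximal _ hne
    have := h P hP
    rw [IsLocalization.algebraMap_mem_map_algebraMap_iff P.primeCompl] at this
    obtain ⟨m, hm, hmz⟩ := this
    exact hm (hle (Submodule.mem_colon_singleton.2 hmz))

lemma gcond_loc (𝔨 : Ideal (𝓞 K)) (a b x y : 𝓞 K) :
    GCond 𝔨 a b x y ↔ ∀ (P : Ideal (𝓞 K)) (_ : P.IsMaximal),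
      GCond (𝔨.map (algebraMap (𝓞 K) (Localization.AtPrime P))) (algebraMap _ _ a)
        (algebraMap _ _ b) (algebraMap _ (Localization.AtPrime P) x) (algebraMap _ _ y) := by
  unfold GCond
  rw [mem_iff_loc]
  refine forall₂_congr fun P hP => ?_
  rw [Ideal.map_mul, Ideal.map_span, Set.image_pair, map_sub, map_mul, map_mul]

lemma global_nonzero (𝔨 : Ideal (𝓞 K)) (h𝔨 : 𝔨 ≠ ⊥) (d₁ d₂ d₃ a b : 𝓞 K) :
    EvPer (fun n => GCond 𝔨 a b (d₁ ^ n - d₃) (d₂ ^ n - d₃)) := by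
  classical
  obtain ⟨k, hk, hk0⟩ := Submodule.exists_mem_ne_zero_of_ne_bot h𝔨
  have hfin := Ring.HasFiniteQuotients.finite_setOfPred_mem k hk0
  set S := hfin.toFinset.filter (fun P => P.IsMaximal ∧ 𝔨 ≤ P) with hS
  have hloc : ∀ P ∈ S, EvPer (fun n => ∀ (_ : P.IsMaximal),
      GCond (𝔨.map (algebraMap (𝓞 K) (Localization.AtPrime P))) (algebraMap _ _ a)
        (algebraMap _ _ b) (algebraMap _ (Localization.AtPrime P) (d₁ ^ n - d₃))
        (algebraMap _ _ (d₂ ^ n - d₃))) := by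
    intro P hP
    rw [hS, Finset.mem_filter] at hP
    obtain ⟨-, hmax, hle⟩ := hP
    have hP0 : P ≠ ⊥ := fun h => h𝔨 (le_bot_iff.1 (h ▸ hle))
    have := loc_dvr P hP0
    have := loc_charZero P
    obtain ⟨p, hp, hpP⟩ := exists_prime_mem P hP0
    set J := 𝔨.map (algebraMap (𝓞 K) (Localization.AtPrime P)) with hJ
    have hJ0 : J ≠ ⊥ := by
      rw [hJ, Ne, Ideal.map_eq_bot_iff_of_injective
        (IsLocalization.injective (Localization.AtPrime P) P.primeCompl_le_nonZeroDivisors)]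
      exact h𝔨
    obtain ⟨κ, hκ⟩ := (IsPrincipalIdealRing.principal J).principal
    change J = Ideal.span {κ} at hκ
    have hκ0 : κ ≠ 0 := by
      rintro rfl
      exact hJ0 (by simpa using hκ)
    have := local_main (loc_fin P hP0) hp (not_isUnit_loc P hpP) hκ0
      (algebraMap _ _ a) (algebraMap _ _ b) (algebraMap _ (Localization.AtPrime P) d₁)
      (algebraMap _ _ d₂) (algebraMap _ _ d₃)
    refine EvPer.congr_ev 0 (fun n _ => ?_) this
    rw [← hκ]
    simp only [map_sub, map_pow]
    exact ⟨fun h => h hmax, fun h _ => h⟩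
  refine EvPer.congr_ev 0 (fun n _ => ?_) (EvPer.forall_finset S _ hloc)
  rw [gcond_loc]
  constructor
  · intro h P _ hmax
    exact h P hmax
  · intro h P hmax
    by_cases hle : 𝔨 ≤ P
    · refine h P ?_ hmax
      rw [hS, Finset.mem_filter]
      exact ⟨by simpa using hle hk, hmax, hle⟩
    · obtain ⟨z, hz, hzP⟩ := SetLike.not_le_iff_exists.1 hle
      have htop : 𝔨.map (algebraMap (𝓞 K) (Localization.AtPrime P)) = ⊤ :=
        Ideal.eq_top_of_isUnit_mem _ (Ideal.mem_map_of_mem _ hz)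
          ((IsLocalization.AtPrime.isUnit_to_map_iff (Localization.AtPrime P) P z).2 hzP)
      unfold GCond
      rw [htop, Ideal.top_mul]
      exact sub_mem (Ideal.mul_mem_left _ _ (Ideal.subset_span (by simp)))
        (Ideal.mul_mem_left _ _ (Ideal.subset_span (by simp)))

lemma exists_good_prime (e : 𝓞 K) (he : e ≠ 0) :
    ∃ (P : Ideal (𝓞 K)) (_ : P.IsPrime) (_ : P ≠ ⊥), e ∉ P := by
  have hfin := Ring.HasFiniteQuotients.finiteQuotient (R := 𝓞 K) (I := Ideal.span {e})
    (by simpa using he)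
  set q := Nat.card (𝓞 K ⧸ Ideal.span {e}) with hq
  have hq0 : q ≠ 0 := Nat.card_pos.ne'
  have hqe : (q : 𝓞 K) ∈ Ideal.span {e} := by
    rw [← Ideal.Quotient.eq_zero_iff_mem, map_natCast, hq]
    have := Fintype.ofFinite (𝓞 K ⧸ Ideal.span {e})
    rw [Nat.card_eq_fintype_card]
    exact Nat.cast_card_eq_zero _
  obtain ⟨p, hle, hp⟩ := Nat.exists_infinite_primes (q + 1)
  have hcop : IsCoprime (p : ℤ) (q : ℤ) := Nat.isCoprime_iff_coprime.2
    ((Nat.Prime.coprime_iff_not_dvd hp).2 fun h =>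
      absurd (Nat.le_of_dvd (Nat.pos_of_ne_zero hq0) h) (by omega))
  have hpu : ¬ IsUnit (p : 𝓞 K) := by
    intro h
    have h1 : IsIntegral ℤ ((p : K)⁻¹) := by
      obtain ⟨v, hv⟩ := h.exists_right_inv
      have h2 : (p : K) * (v : K) = 1 := by
        have := congrArg (algebraMap (𝓞 K) K) hv
        simpa using this
      rw [inv_eq_of_mul_eq_one_right h2]
      exact v.2
    have h3 : IsIntegral ℤ ((p : ℚ)⁻¹) := by
      rw [← isIntegral_algebraMap_iff (algebraMap ℚ K).injective]
      simpa using h1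
    obtain ⟨z, hz⟩ := IsIntegrallyClosed.isIntegral_iff.1 h3
    have hp0 : (p : ℚ) ≠ 0 := by exact_mod_cast hp.ne_zero
    have h4 : (z : ℚ) * p = 1 := by
      have : (z : ℚ) = (p : ℚ)⁻¹ := by simpa using hz
      rw [this, inv_mul_cancel₀ hp0]
    have h5 : z * (p : ℤ) = 1 := by exact_mod_cast h4
    have h6 := Int.natAbs_dvd_natAbs.2 (Dvd.intro_left z h5)
    simp at h6
    exact hp.one_lt.ne' h6
  obtain ⟨P, hP, hPle⟩ := Ideal.exists_le_maximal (Ideal.span {(p : 𝓞 K)})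
    (by rwa [Ne, Ideal.span_singleton_eq_top])
  have hpP : (p : 𝓞 K) ∈ P := hPle (Ideal.mem_span_singleton_self _)
  refine ⟨P, hP.isPrime, ?_, ?_⟩
  · rintro rfl
    have : (p : 𝓞 K) = 0 := by simpa using hpP
    exact hp.ne_zero (by exact_mod_cast this)
  · intro heP
    have hqP : (q : 𝓞 K) ∈ P := (Ideal.span_singleton_le_iff_mem P).2 heP hqe
    obtain ⟨u, v, huv⟩ := hcop
    have h2 : (u : 𝓞 K) * p + v * q = 1 := by
      exact_mod_cast congrArg (Int.cast : ℤ → 𝓞 K) huv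
    apply hP.ne_top
    rw [Ideal.eq_top_iff_one, ← h2]
    exact add_mem (Ideal.mul_mem_left _ _ hpP) (Ideal.mul_mem_left _ _ hqP)

lemma sml_global (c₁ c₂ c₃ d₁ d₂ : 𝓞 K) :
    EvPer (fun n => c₁ * d₁ ^ n + c₂ * d₂ ^ n + c₃ = 0) := by
  wlog h1 : d₁ ≠ 0 generalizing c₁ d₁
  · rw [not_not] at h1
    subst h1
    refine EvPer.congr_ev 1 (fun n hn => ?_) (this 0 1 one_ne_zero)
    rw [zero_pow (by omega)]
    simp
  wlog h2 : d₂ ≠ 0 generalizing c₂ d₂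
  · rw [not_not] at h2
    subst h2
    refine EvPer.congr_ev 1 (fun n hn => ?_) (this 0 1 one_ne_zero)
    rw [zero_pow (by omega)]
    simp
  obtain ⟨P, hP, hP0, he⟩ := exists_good_prime (d₁ * d₂) (mul_ne_zero h1 h2)
  have := loc_dvr P hP0
  have := loc_charZero P
  obtain ⟨p, hp, hpP⟩ := exists_prime_mem P hP0
  have hu : ∀ d : 𝓞 K, d ∉ P → IsUnit (algebraMap (𝓞 K) (Localization.AtPrime P) d) :=
    fun d hd => (IsLocalization.AtPrime.isUnit_to_map_iff (Localization.AtPrime P) P d).2 hd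
  have := sml_local (loc_fin P hP0) hp (not_isUnit_loc P hpP)
    (algebraMap _ _ c₁) (algebraMap _ _ c₂) (algebraMap _ _ c₃)
    (algebraMap (𝓞 K) (Localization.AtPrime P) d₁) (algebraMap _ _ d₂)
    (hu _ fun h => he (Ideal.mul_mem_right _ _ h)) (hu _ fun h => he (Ideal.mul_mem_left _ _ h))
  refine EvPer.congr_ev 0 (fun n _ => ?_) this
  rw [← map_pow, ← map_pow, ← map_mul, ← map_mul, ← map_add, ← map_add]
  exact (map_eq_zero_iff _ (IsLocalization.injective (Localization.AtPrime P)
    P.primeCompl_le_nonZeroDivisors)).symm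

end global_part

/-- Proposition 1.11: an arithmetic-progression structure for a gcd-type
divisibility condition in the ring of integers of a number field. -/
theorem stmt12 (K : Type*) [Field K] [NumberField K]
    (𝔨 : Ideal (NumberField.RingOfIntegers K))
    (d₁ d₂ d₃ a b : NumberField.RingOfIntegers K) :
    ∃ s : Finset (ℕ × ℕ),
      {n : ℕ | b * (d₁ ^ n - d₃) - a * (d₂ ^ n - d₃) ∈
        𝔨 * Ideal.span {d₁ ^ n - d₃, d₂ ^ n - d₃}} =
      ⋃ p ∈ s, {n : ℕ | ∃ k : ℕ, n = p.1 + p.2 * k} := by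
  apply EvPer.toAP
  by_cases h𝔨 : 𝔨 = ⊥
  · subst h𝔨
    refine EvPer.congr_ev 0 (fun n _ => ?_) (sml_global b (-a) (a * d₃ - b * d₃) d₁ d₂)
    rw [Ideal.bot_mul, Ideal.mem_bot]
    have : b * d₁ ^ n + -a * d₂ ^ n + (a * d₃ - b * d₃) =
      b * (d₁ ^ n - d₃) - a * (d₂ ^ n - d₃) := by ring
    rw [this]
  · exact global_nonzero 𝔨 h𝔨 d₁ d₂ d₃ a b
end
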